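/- Let n ≥ 2. For every u ∈ C^∞(closure of ℝⁿ₊) with compact support and u = 0 on the hyperplane {x_n = 0}, the sharp inequality ∫_{ℝⁿ₊} |∇u|² dx ≥ (1/4) ∫_{ℝⁿ₊} |u|²/x_n² dx + ( π^{n/(n+1)} (n² − 1) / ( 4 · ( Γ(n/2 + 1) )^{2/(n+1)} ) ) · ( ∫_{ℝⁿ₊} x_n^{−2/(n−1)} |u|^{2(n+1)/(n−1)} dx )^{(n−1)/(n+1)} holds. -/

import Mathlib

open MeasureTheory
open scoped Real

noncomputable section

/-- Partial derivative of a real-valued function on `ℝⁿ` in the `i`-th coordinate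
direction. -/
def pdn {n : ℕ} (i : Fin n) (u : EuclideanSpace ℝ (Fin n) → ℝ)
    (x : EuclideanSpace ℝ (Fin n)) : ℝ :=
  fderiv ℝ u x (EuclideanSpace.single i 1)

section

open Set Filter Topology

theorem integrable_and_integral_one_add_sq_rpow {α : ℝ} (hα : 1 / 2 < α) :
    Integrable (fun y : ℝ => (1 + y ^ 2) ^ (-α)) ∧
      ∫ y : ℝ, (1 + y ^ 2) ^ (-α) = √π * Real.Gamma (α - 1 / 2) / Real.Gamma α := by
  have hα0 : 0 < α := by linarith
  have hΓ : 0 < Real.Gamma α := Real.Gamma_pos_of_pos hα0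
  set f : ℝ → ℝ → ℝ := fun y s => s ^ (α - 1) * Real.exp (-((1 + y ^ 2) * s)) with hf
  have hslice : ∀ y : ℝ, ∫ s in Ioi (0 : ℝ), f y s = (1 + y ^ 2) ^ (-α) * Real.Gamma α := by
    intro y
    have hy : 0 < 1 + y ^ 2 := by positivity
    simp only [hf]
    rw [Real.integral_rpow_mul_exp_neg_mul_Ioi hα0 hy, one_div, Real.inv_rpow hy.le,
      Real.rpow_neg hy.le]
  have hgauss : ∀ s ∈ Ioi (0 : ℝ),
      ∫ y : ℝ, f y s = √π * (Real.exp (-s) * s ^ (α - 1 / 2 - 1)) := by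
    intro s hs
    have hs : 0 < s := hs
    have : ∀ y, f y s = s ^ (α - 1) * Real.exp (-s) * Real.exp (-s * y ^ 2) := by
      intro y
      simp only [hf]
      rw [mul_assoc, ← Real.exp_add]
      ring_nf
    simp_rw [this]
    rw [integral_const_mul, integral_gaussian, Real.sqrt_div' _ hs.le, Real.sqrt_eq_rpow s,
      show α - 1 / 2 - 1 = (α - 1) - 1 / 2 by ring, Real.rpow_sub hs (α - 1)]
    ring
  have hmeas : AEStronglyMeasurable (Function.uncurry f)
      ((volume : Measure ℝ).prod (volume.restrict (Ioi (0 : ℝ)))) := by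
    apply Measurable.aestronglyMeasurable
    simp only [hf, Function.uncurry_def]
    fun_prop
  have hGint : IntegrableOn (fun s : ℝ => √π * (Real.exp (-s) * s ^ (α - 1 / 2 - 1)))
      (Ioi (0 : ℝ)) :=
    (Real.GammaIntegral_convergent (by linarith : 0 < α - 1 / 2)).const_mul _
  have hint : Integrable (Function.uncurry f)
      ((volume : Measure ℝ).prod (volume.restrict (Ioi (0 : ℝ)))) := by
    rw [integrable_prod_iff' hmeas]
    constructor
    · filter_upwards [ae_restrict_mem measurableSet_Ioi] with s hs
      have hs : 0 < s := hs
      have : ∀ y, Function.uncurry f (y, s) =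
          s ^ (α - 1) * Real.exp (-s) * Real.exp (-s * y ^ 2) := by
        intro y
        simp only [hf, Function.uncurry_apply_pair]
        rw [mul_assoc, ← Real.exp_add]
        ring_nf
      simp_rw [this]
      exact (integrable_exp_neg_mul_sq hs).const_mul _
    · refine hGint.congr ?_
      filter_upwards [ae_restrict_mem measurableSet_Ioi] with s hs
      rw [← hgauss s hs]
      refine integral_congr_ae (ae_of_all _ fun y => ?_)
      have hs : 0 < s := hs
      simp only [hf, Function.uncurry_apply_pair]
      rw [Real.norm_of_nonneg (by positivity)]
  have hswap := integral_integral_swap hint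
  rw [setIntegral_congr_fun measurableSet_Ioi hgauss] at hswap
  simp_rw [hslice] at hswap
  rw [integral_mul_const, integral_const_mul,
    ← Real.Gamma_eq_integral (by linarith : 0 < α - 1 / 2)] at hswap
  refine ⟨?_, by rw [eq_div_iff hΓ.ne', hswap]⟩
  have h1 := hint.integral_prod_left
  simp only [Function.uncurry_apply_pair] at h1
  simp_rw [hslice] at h1
  have h2 := h1.mul_const (Real.Gamma α)⁻¹
  refine h2.congr (ae_of_all _ fun y => ?_)
  simp only
  field_simp

theorem integrable_and_integral_sq_mul_one_add_sq_rpow {α : ℝ} (hα : 3 / 2 < α) :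
    Integrable (fun y : ℝ => y ^ 2 * (1 + y ^ 2) ^ (-α)) ∧
      ∫ y : ℝ, y ^ 2 * (1 + y ^ 2) ^ (-α) =
        (∫ y : ℝ, (1 + y ^ 2) ^ (-α)) / (2 * α - 3) := by
  obtain ⟨hi, he⟩ := integrable_and_integral_one_add_sq_rpow (by linarith : 1 / 2 < α)
  obtain ⟨hi', he'⟩ := integrable_and_integral_one_add_sq_rpow (by linarith : 1 / 2 < α - 1)
  have hpt : ∀ y : ℝ, y ^ 2 * (1 + y ^ 2) ^ (-α) =
      (1 + y ^ 2) ^ (-(α - 1)) - (1 + y ^ 2) ^ (-α) := by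
    intro y
    have hy : 0 < 1 + y ^ 2 := by positivity
    rw [show -(α - 1) = -α + 1 by ring, Real.rpow_add_one hy.ne']
    ring
  simp_rw [hpt]
  refine ⟨hi'.sub hi, ?_⟩
  rw [integral_sub hi' hi, he, he']
  have h1 : Real.Gamma α = (α - 1) * Real.Gamma (α - 1) := by
    have := Real.Gamma_add_one (s := α - 1) (by linarith)
    rwa [sub_add_cancel] at this
  have h2 : Real.Gamma (α - 1 / 2) = (α - 3 / 2) * Real.Gamma (α - 1 - 1 / 2) := by
    have := Real.Gamma_add_one (s := α - 1 - 1 / 2) (by linarith)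
    rw [← show α - 1 - 1 / 2 = α - 3 / 2 by ring, ← this]
    ring_nf
  have h3 : 0 < Real.Gamma (α - 1) := Real.Gamma_pos_of_pos (by linarith)
  have h4 : α - 1 ≠ 0 := by linarith
  have h5 : 2 * α - 3 ≠ 0 := by linarith
  rw [h1, h2, show α - 3 / 2 = (2 * α - 3) / 2 by ring]
  generalize Real.Gamma (α - 1 - 1 / 2) = g, Real.Gamma (α - 1) = g' at h3 ⊢
  obtain ⟨d, rfl⟩ : ∃ d, α = (d + 3) / 2 := ⟨2 * α - 3, by ring⟩
  have h6 : (d + 3) / 2 - 1 = (d + 1) / 2 := by ring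
  have h7 : 2 * ((d + 3) / 2) - 3 = d := by ring
  rw [h6] at h4
  rw [h7] at h5
  have h8 : d + 1 ≠ 0 := fun h => h4 (by rw [h]; simp)
  rw [h6, h7]
  field_simp
  ring

theorem exists_bound_of_hasCompactSupport {b : ℝ → ℝ} (hcs : HasCompactSupport b) :
    ∃ R : ℝ, 0 < R ∧ ∀ s, s ∉ Ioc (-R) R → b s = 0 := by
  obtain ⟨R, hR⟩ := hcs.isCompact.isBounded.subset_ball (0 : ℝ)
  refine ⟨max R 1, by positivity, fun s hs => ?_⟩
  by_contra h
  have := hR (subset_tsupport _ h)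
  rw [mem_ball_zero_iff, Real.norm_eq_abs, abs_lt] at this
  exact hs ⟨by linarith [le_max_left R 1], by linarith [le_max_left R 1]⟩

theorem exists_hasDerivAt_transport {b : ℝ → ℝ} (hb : Continuous b) (hcs : HasCompactSupport b)
    (hb0 : ∀ s, 0 ≤ b s) (hB : 0 < ∫ s, b s) {α L : ℝ} (hα : 0 ≤ α) (hL : 0 < L) :
    ∃ T : ℝ → ℝ,
      (∀ s, HasDerivAt T
        ((∫ y in -L..L, (1 + y ^ 2) ^ (-α)) / (∫ s, b s) * b s * (1 + T s ^ 2) ^ α) s) ∧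
      ∫ s, b s * T s ^ 2 =
        (∫ s, b s) / (∫ y in -L..L, (1 + y ^ 2) ^ (-α)) *
          ∫ y in -L..L, y ^ 2 * (1 + y ^ 2) ^ (-α) := by
  set w : ℝ → ℝ := fun y => (1 + y ^ 2) ^ (-α) with hw
  have hpos : ∀ y : ℝ, 0 < 1 + y ^ 2 := fun y => by positivity
  have hwpos : ∀ y, 0 < w y := fun y => Real.rpow_pos_of_pos (hpos y) _
  have hwc : Continuous w := by
    refine Continuous.rpow_const (by fun_prop) fun y => Or.inl (hpos y).ne'
  set B := ∫ s, b s with hBdef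
  set J := ∫ y in -L..L, w y with hJ
  have hJpos : 0 < J :=
    intervalIntegral.intervalIntegral_pos_of_pos (hwc.intervalIntegrable _ _) hwpos (by linarith)
  set c := w L with hc
  have hcpos : 0 < c := hwpos L
  set h : ℝ → ℝ := fun y => max (w y) c with hh
  have hhc : Continuous h := hwc.max continuous_const
  have hhw : ∀ y ∈ Icc (-L) L, h y = w y := by
    intro y hy
    refine max_eq_left ?_
    have : y ^ 2 ≤ L ^ 2 := sq_le_sq' hy.1 hy.2
    exact Real.rpow_le_rpow_of_nonpos (hpos y) (by linarith) (by linarith)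
  set H : ℝ → ℝ := fun y => ∫ x in -L..y, h x with hH
  have hHd : ∀ y, HasDerivAt H (h y) y := fun y => (hhc.integral_hasStrictDerivAt _ y).hasDerivAt
  have hHmono : StrictMono H :=
    strictMono_of_hasDerivAt_pos hHd fun y => lt_max_of_lt_right hcpos
  have hHcont : Continuous H := continuous_iff_continuousAt.2 fun y => (hHd y).continuousAt
  have hlin : Monotone fun y => H y - c * y := by
    refine monotone_of_hasDerivAt_nonneg
      (f' := fun y => h y - c * 1) (fun y => (hHd y).sub ((hasDerivAt_id y).const_mul c)) ?_
    intro y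
    simp [hh]
  have hsurj : Function.Surjective H := by
    refine hHcont.surjective ?_ ?_
    · refine tendsto_atTop_mono' _ ?_
        (tendsto_atTop_add_const_left _ (H 0) (tendsto_id.const_mul_atTop hcpos))
      filter_upwards [eventually_ge_atTop 0] with y hy
      have := hlin hy
      simp only [mul_zero, sub_zero, id] at this ⊢
      linarith
    · refine tendsto_atBot_mono' _ ?_
        (tendsto_atBot_add_const_left _ (H 0) (tendsto_id.const_mul_atBot hcpos))
      filter_upwards [eventually_le_atBot 0] with y hy
      have := hlin hy
      simp only [mul_zero, sub_zero, id] at this ⊢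
      linarith
  set e := hHmono.orderIsoOfSurjective H hsurj with he
  have heH : ∀ z, H (e.symm z) = z := fun z => e.apply_symm_apply z
  have hHe : ∀ y, e.symm (H y) = y := fun y => e.symm_apply_apply y
  have hed : ∀ z, HasDerivAt e.symm (h (e.symm z))⁻¹ z := fun z =>
    HasDerivAt.of_local_left_inverse e.symm.continuous.continuousAt (hHd _)
      (lt_max_of_lt_right hcpos).ne' (Eventually.of_forall heH)
  have hH0 : H (-L) = 0 := by simp [hH]
  have hHL : H L = J := by
    refine intervalIntegral.integral_congr fun y hy => hhw y ?_
    rwa [uIcc_of_le (by linarith)] at hy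
  obtain ⟨R, hR0, hR⟩ := exists_bound_of_hasCompactSupport hcs
  set F : ℝ → ℝ := fun s => ∫ x in -R..s, b x with hF
  have hFd : ∀ s, HasDerivAt F (b s) s := fun s => (hb.integral_hasStrictDerivAt _ s).hasDerivAt
  have hF0 : F (-R) = 0 := by simp [hF]
  have hfull : ∀ g : ℝ → ℝ, (∀ s, b s = 0 → g s = 0) → ∫ s in -R..R, g s = ∫ s, g s := by
    intro g hg
    rw [intervalIntegral.integral_of_le (by linarith)]
    exact setIntegral_eq_integral_of_forall_compl_eq_zero fun s hs => hg s (hR s hs)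
  have hFR : F R = B := hfull b fun s hs => hs
  have hFmono : Monotone F := monotone_of_hasDerivAt_nonneg hFd hb0
  set κ := J / B with hκ
  have hκpos : 0 < κ := div_pos hJpos hB
  have hκB : κ * B = J := div_mul_cancel₀ _ hB.ne'
  set T : ℝ → ℝ := fun s => e.symm (κ * F s) with hT
  have hTd' : ∀ s, HasDerivAt T ((h (T s))⁻¹ * (κ * b s)) s := fun s =>
    (hed (κ * F s)).comp s ((hFd s).const_mul κ)
  have hTL : T (-R) = -L := by simp only [hT, hF0, mul_zero]; rw [← hH0, hHe]
  have hTR : T R = L := by simp only [hT, hFR, hκB]; rw [← hHL, hHe]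
  have hTmono : Monotone T := fun s t hst =>
    e.symm.monotone (mul_le_mul_of_nonneg_left (hFmono hst) hκpos.le)
  have hTder : ∀ s, (h (T s))⁻¹ * (κ * b s) = κ * b s * (1 + T s ^ 2) ^ α := by
    intro s
    by_cases hs : s ∈ Ioc (-R) R
    · rw [hhw (T s) ⟨hTL ▸ hTmono hs.1.le, hTR ▸ hTmono hs.2⟩]
      simp only [hw]
      rw [Real.rpow_neg (hpos _).le, inv_inv]
      ring
    · simp [hR s hs]
  have hTd : ∀ s, HasDerivAt T (κ * b s * (1 + T s ^ 2) ^ α) s := fun s => hTder s ▸ hTd' s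
  have hTcont : Continuous T := continuous_iff_continuousAt.2 fun y => (hTd y).continuousAt
  refine ⟨T, hTd, ?_⟩
  have hsub := intervalIntegral.integral_comp_mul_deriv (a := -R) (b := R)
    (g := fun y : ℝ => y ^ 2 * w y) (fun s _ => hTd s) ?_ (by fun_prop)
  · rw [hTL, hTR] at hsub
    have hpt : ∀ s, ((fun y : ℝ => y ^ 2 * w y) ∘ T) s * (κ * b s * (1 + T s ^ 2) ^ α) =
        κ * (b s * T s ^ 2) := by
      intro s
      have : (1 + T s ^ 2) ^ (-α) * (1 + T s ^ 2) ^ α = 1 := by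
        rw [← Real.rpow_add (hpos _)]; simp
      simp only [hw, Function.comp]
      linear_combination (T s ^ 2 * κ * b s) * this
    simp_rw [hpt] at hsub
    rw [intervalIntegral.integral_const_mul,
      hfull (fun s => b s * T s ^ 2) fun s hs => by simp [hs]] at hsub
    rw [← hsub, hκ]
    field_simp
  · refine Continuous.continuousOn ?_
    refine (hb.const_mul κ).mul
      (Continuous.rpow_const (by fun_prop) fun s => Or.inl (hpos _).ne')

theorem HasCompactSupport.slice {k : ℕ} {f : ℝ × (Fin k → ℝ) → ℝ} (hc : HasCompactSupport f)
    (s : ℝ) :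
    HasCompactSupport fun y => f (s, y) := by
  refine HasCompactSupport.intro (hc.isCompact.image continuous_snd) fun y hy => ?_
  by_contra h
  exact hy ⟨(s, y), subset_tsupport _ h, rfl⟩

theorem HasCompactSupport.slice_fst {k : ℕ} {f : ℝ × (Fin k → ℝ) → ℝ} (hc : HasCompactSupport f)
    (y : Fin k → ℝ) :
    HasCompactSupport fun s => f (s, y) := by
  refine HasCompactSupport.intro (hc.isCompact.image continuous_fst) fun s hs => ?_
  by_contra h
  exact hs ⟨(s, y), subset_tsupport _ h, rfl⟩

theorem HasCompactSupport.integral_slice {k : ℕ} {f : ℝ × (Fin k → ℝ) → ℝ}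
    (hc : HasCompactSupport f) :
    HasCompactSupport fun s => ∫ y, f (s, y) := by
  refine HasCompactSupport.intro (hc.isCompact.image continuous_fst) fun s hs => ?_
  have : ∀ y, f (s, y) = 0 := by
    intro y
    by_contra h
    exact hs ⟨(s, y), subset_tsupport _ h, rfl⟩
  simp [this]

theorem Continuous.integral_slice {k : ℕ} {f : ℝ × (Fin k → ℝ) → ℝ} (hf : Continuous f)
    (hc : HasCompactSupport f) :
    Continuous fun s => ∫ y, f (s, y) := by
  have hK := hc.isCompact.image (continuous_snd (X := ℝ) (Y := Fin k → ℝ))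
  have := continuous_parametric_integral_of_continuous (μ := (volume : Measure (Fin k → ℝ)))
    (f := fun s y => f (s, y)) hf hK
  convert this using 2 with s
  refine (setIntegral_eq_integral_of_forall_compl_eq_zero fun y hy => ?_).symm
  by_contra h
  exact hy ⟨(s, y), subset_tsupport _ h, rfl⟩

theorem integral_prod_eq_of_continuous {k : ℕ} {f : ℝ × (Fin k → ℝ) → ℝ} (hf : Continuous f)
    (hc : HasCompactSupport f) : ∫ z, f z = ∫ s, ∫ y, f (s, y) :=
  integral_prod f (hf.integrable_of_hasCompactSupport hc)

theorem integral_eq_zero_of_hasDerivAt_fst {k : ℕ} {g g' : ℝ × (Fin k → ℝ) → ℝ} (hg : Continuous g)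
    (hgc : HasCompactSupport g) (hg' : Continuous g') (hgc' : HasCompactSupport g')
    (hd : ∀ s y, HasDerivAt (fun s => g (s, y)) (g' (s, y)) s) : ∫ z, g' z = 0 := by
  have h1 : ∫ z, g' z = ∫ y, ∫ s, g' (s, y) :=
    integral_prod_symm g' (hg'.integrable_of_hasCompactSupport hgc')
  rw [h1]
  refine integral_eq_zero_of_ae (ae_of_all _ fun y => ?_)
  exact integral_eq_zero_of_hasDerivAt_of_integrable (fun s => hd s y)
    ((hg'.comp (by fun_prop)).integrable_of_hasCompactSupport (hgc'.slice_fst y))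
    ((hg.comp (by fun_prop)).integrable_of_hasCompactSupport (hgc.slice_fst y))

/-- The right-hand side of the sharp Gagliardo–Nirenberg inequality in codimension `d` (relative to
the dimension `N`), in terms of the integrals `b` of `|v| ^ (2 * N / (N - 2))` and `a` of
`|v| ^ (2 * (N - 1) / (N - 2))`. -/
def gnLower (N M d A r b a : ℝ) : ℝ :=
  (N - 2) ^ 2 / (N - 1) * (A * r ^ 2 * b - d * r * (r ^ N * b / M) ^ (1 / d) * a)

theorem neg_mul_le_sq_add {N r T w x P : ℝ} (hN : 2 < N)
    (hP : P = |w| ^ (2 * N / (N - 2))) :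
    -((N - 2) ^ 2 / (N - 1) * r *
        (T * (2 * (N - 1) / (N - 2) * |w| ^ (2 * (N - 1) / (N - 2) - 2) * w * x))) ≤
      x ^ 2 + (N - 2) ^ 2 / (N - 1) * (N - 1) * r ^ 2 * (P * T ^ 2) := by
  have h2 : N - 2 ≠ 0 := by linarith
  have h1 : N - 1 ≠ 0 := by linarith
  have hsq : P = (|w| ^ (2 * (N - 1) / (N - 2) - 2) * w) ^ 2 := by
    rw [hP, mul_pow, ← sq_abs w]
    rcases eq_or_ne w 0 with rfl | hw
    · rw [abs_zero, Real.zero_rpow]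
      · simp
      · have : 0 < N - 2 := by linarith
        positivity
    · have hw' : 0 < |w| := abs_pos.2 hw
      rw [← Real.rpow_natCast, ← Real.rpow_mul hw'.le, ← Real.rpow_natCast, ← Real.rpow_add hw']
      congr 1
      push_cast
      field_simp
      ring
  rw [hsq]
  set z := |w| ^ (2 * (N - 1) / (N - 2) - 2) * w with hz
  have : (N - 2) ^ 2 / (N - 1) * r * (T * (2 * (N - 1) / (N - 2) *
      |w| ^ (2 * (N - 1) / (N - 2) - 2) * w * x)) = 2 * ((N - 2) * r * T * z) * x := by
    rw [hz]
    field_simp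
  rw [this, div_mul_cancel₀ _ h1]
  nlinarith [sq_nonneg (x + (N - 2) * r * T * z)]

theorem mul_rpow_one_div_le {d X Y : ℝ} (hd : 1 < d) (hX : 0 ≤ X) (hY : 0 ≤ Y) :
    d * (X * Y) ^ (1 / d) ≤ X + (d - 1) * Y ^ (1 / (d - 1)) := by
  have hd0 : 0 < d := by linarith
  have hd1 : 0 < d - 1 := by linarith
  have h := Real.geom_mean_le_arith_mean2_weighted (w₁ := 1 / d) (w₂ := (d - 1) / d)
    (p₁ := X) (p₂ := Y ^ (1 / (d - 1))) (by positivity) (by positivity) hX (by positivity)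
    (by field_simp; ring)
  rw [← Real.rpow_mul hY, show 1 / (d - 1) * ((d - 1) / d) = 1 / d by field_simp,
    ← Real.mul_rpow hX hY] at h
  calc d * (X * Y) ^ (1 / d) ≤ d * (1 / d * X + (d - 1) / d * Y ^ (1 / (d - 1))) := by gcongr
    _ = _ := by field_simp

theorem continuous_abs_rpow_comp {X : Type*} [TopologicalSpace X] {f : X → ℝ} (hf : Continuous f)
    {p : ℝ} (hp : 0 ≤ p) : Continuous fun z => |f z| ^ p :=
  hf.abs.rpow_const fun _ => Or.inr hp

theorem HasCompactSupport.abs_rpow {X : Type*} [TopologicalSpace X] {f : X → ℝ}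
    (hf : HasCompactSupport f) {p : ℝ} (hp : p ≠ 0) : HasCompactSupport fun z => |f z| ^ p :=
  hf.comp_left (g := fun w : ℝ => |w| ^ p) (by simp [hp])

theorem gnLower_transport_le {N M d A r κ b a x : ℝ} (hM : 0 < M) (hN : 2 < N) (hd : 1 < d)
    (hr : 0 ≤ r) (hκ : 0 < κ) (hb : 0 ≤ b) (ha : 0 ≤ a) :
    (N - 2) ^ 2 / (N - 1) * (A * r ^ 2 * (b + b * x ^ 2) -
        r * (κ * b * (1 + x ^ 2) ^ ((N + d) / 2) * a) -
        (d - 1) * r * (r ^ N / (κ * M)) ^ (1 / (d - 1)) * a) ≤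
      gnLower N M d A (r * √(1 + x ^ 2)) b a := by
  have hx : 0 < 1 + x ^ 2 := by positivity
  have hd0 : 0 < d := by linarith
  have hN1 : 0 < N - 1 := by linarith
  set τ := √(1 + x ^ 2) with hτ
  have hτ0 : 0 < τ := Real.sqrt_pos.2 hx
  have hτ2 : τ ^ 2 = 1 + x ^ 2 := Real.sq_sqrt hx.le
  have hτp : (1 + x ^ 2) ^ ((N + d) / 2) = τ ^ (N + d) := by
    rw [hτ, Real.sqrt_eq_rpow, ← Real.rpow_mul hx.le]
    congr 1
    ring
  rw [hτp]
  set X := κ * b * τ ^ (N + d) with hX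
  set Y := r ^ N / (κ * M) with hY
  have hX0 : 0 ≤ X := by positivity
  have hY0 : 0 ≤ Y := by positivity
  have hXY : τ * ((r * τ) ^ N * b / M) ^ (1 / d) = (X * Y) ^ (1 / d) := by
    have h1 : τ = (τ ^ d) ^ (1 / d) := by
      rw [← Real.rpow_mul hτ0.le, mul_one_div_cancel hd0.ne', Real.rpow_one]
    calc τ * ((r * τ) ^ N * b / M) ^ (1 / d)
        = (τ ^ d) ^ (1 / d) * ((r * τ) ^ N * b / M) ^ (1 / d) := by rw [← h1]
      _ = (X * Y) ^ (1 / d) := by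
        rw [← Real.mul_rpow (by positivity) (by positivity), hX, hY, Real.mul_rpow hr hτ0.le,
          Real.rpow_add hτ0]
        congr 1
        field_simp
  have key := mul_rpow_one_div_le hd hX0 hY0
  unfold gnLower
  refine mul_le_mul_of_nonneg_left ?_ (by positivity)
  have h2 : d * (r * τ) * ((r * τ) ^ N * b / M) ^ (1 / d) * a =
      r * a * (d * (X * Y) ^ (1 / d)) := by rw [← hXY]; ring
  have h3 := mul_le_mul_of_nonneg_left key (mul_nonneg hr ha)
  rw [h2, mul_pow, hτ2]
  nlinarith [h3]

theorem gnLower_step_truncated {k : ℕ} {N M d A : ℝ} (hM : 0 < M) (hN : 2 < N) (hd : 1 < d)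
    {V D : ℝ × (Fin k → ℝ) → ℝ} (hV : ContDiff ℝ 1 V) (hVc : HasCompactSupport V)
    (hD : Continuous D) (hDc : HasCompactSupport D)
    (hslice : ∀ s r, 0 ≤ r → gnLower N M d A r (∫ y, |V (s, y)| ^ (2 * N / (N - 2)))
      (∫ y, |V (s, y)| ^ (2 * (N - 1) / (N - 2))) ≤ ∫ y, D (s, y))
    (hB : 0 < ∫ z, |V z| ^ (2 * N / (N - 2))) {L : ℝ} (hL : 0 < L) {r : ℝ} (hr : 0 ≤ r) :
    gnLower N (M * ∫ y in -L..L, (1 + y ^ 2) ^ (-((N + d) / 2))) (d - 1)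
      (A + (A - (N - 1)) * ((∫ y in -L..L, y ^ 2 * (1 + y ^ 2) ^ (-((N + d) / 2))) /
        ∫ y in -L..L, (1 + y ^ 2) ^ (-((N + d) / 2)))) r
      (∫ z, |V z| ^ (2 * N / (N - 2))) (∫ z, |V z| ^ (2 * (N - 1) / (N - 2))) ≤
      ∫ z, (D z + fderiv ℝ V z (1, 0) ^ 2) := by
  have hN2 : 0 < N - 2 := by linarith
  have hN1 : 0 < N - 1 := by linarith
  set c := (N - 2) ^ 2 / (N - 1) with hc
  have hc0 : 0 < c := by positivity
  set p := 2 * N / (N - 2) with hp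
  set q := 2 * (N - 1) / (N - 2) with hq
  have hp0 : 0 < p := by positivity
  have hq2 : 2 < q := by rw [hq, lt_div_iff₀ hN2]; linarith
  set P : ℝ × (Fin k → ℝ) → ℝ := fun z => |V z| ^ p with hP
  set Q : ℝ × (Fin k → ℝ) → ℝ := fun z => |V z| ^ q with hQ
  set W : ℝ × (Fin k → ℝ) → ℝ := fun z => fderiv ℝ V z (1, 0) with hW
  set G : ℝ × (Fin k → ℝ) → ℝ := fun z => q * |V z| ^ (q - 2) * V z * W z with hG
  have hPc : Continuous P := continuous_abs_rpow_comp hV.continuous hp0.le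
  have hQc : Continuous Q := continuous_abs_rpow_comp hV.continuous (by linarith)
  have hPs : HasCompactSupport P := hVc.abs_rpow hp0.ne'
  have hQs : HasCompactSupport Q := hVc.abs_rpow (by linarith)
  have hWc : Continuous W := (hV.continuous_fderiv one_ne_zero).clm_apply continuous_const
  have hWs : HasCompactSupport W := hVc.fderiv_apply ℝ (1, 0)
  have hGc : Continuous G :=
    ((continuous_const.mul (continuous_abs_rpow_comp hV.continuous (by linarith))).mul
      hV.continuous).mul hWc
  have hGs : HasCompactSupport G := hWs.mul_left
  have hP0 : ∀ z, 0 ≤ P z := fun z => by positivity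
  have hQ0 : ∀ z, 0 ≤ Q z := fun z => by positivity
  set b : ℝ → ℝ := fun s => ∫ y, P (s, y) with hb
  set a : ℝ → ℝ := fun s => ∫ y, Q (s, y) with ha
  have hbc : Continuous b := hPc.integral_slice hPs
  have hbs : HasCompactSupport b := hPs.integral_slice
  have hac : Continuous a := hQc.integral_slice hQs
  have has : HasCompactSupport a := hQs.integral_slice
  have hb0 : ∀ s, 0 ≤ b s := fun s => integral_nonneg fun y => hP0 _
  have ha0 : ∀ s, 0 ≤ a s := fun s => integral_nonneg fun y => hQ0 _
  have hbB : ∫ s, b s = ∫ z, P z := (integral_prod_eq_of_continuous hPc hPs).symm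
  have haA : ∫ s, a s = ∫ z, Q z := (integral_prod_eq_of_continuous hQc hQs).symm
  set B := ∫ z, P z with hBdef
  set J := ∫ y in -L..L, (1 + y ^ 2) ^ (-((N + d) / 2)) with hJ
  set J₂ := ∫ y in -L..L, y ^ 2 * (1 + y ^ 2) ^ (-((N + d) / 2)) with hJ₂
  have hJ0 : 0 < J := by
    refine intervalIntegral.intervalIntegral_pos_of_pos (Continuous.intervalIntegrable ?_ _ _)
      (fun y => by positivity) (by linarith)
    exact Continuous.rpow_const (by fun_prop) fun y => Or.inl (by positivity)
  obtain ⟨T, hT, hTint⟩ := exists_hasDerivAt_transport hbc hbs hb0 (hbB ▸ hB)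
    (α := (N + d) / 2) (by linarith) hL
  rw [hbB] at hT hTint
  rw [← hJ, ← hJ₂] at hTint
  set κ := J / B with hκ
  have hκ0 : 0 < κ := div_pos hJ0 hB
  set T' : ℝ → ℝ := fun s => κ * b s * (1 + T s ^ 2) ^ ((N + d) / 2) with hT'
  have hTc : Continuous T := continuous_iff_continuousAt.2 fun y => (hT y).continuousAt
  have hT'c : Continuous T' := (hbc.const_mul κ).mul
    (Continuous.rpow_const (by fun_prop) fun s => Or.inl (by positivity))
  set Y := (r ^ N / (κ * M)) ^ (1 / (d - 1)) with hY
  have hDlow : ∫ s, c * (A * r ^ 2 * (b s + b s * T s ^ 2) - r * (T' s * a s) -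
      (d - 1) * r * Y * a s) ≤ ∫ z, D z := by
    rw [integral_prod_eq_of_continuous hD hDc]
    refine integral_mono ?_ ?_ fun s => ?_
    · refine Continuous.integrable_of_hasCompactSupport (by fun_prop) ?_
      refine HasCompactSupport.mul_left ?_
      exact ((((hbs.add hbs.mul_right).mul_left).sub (has.mul_left.mul_left)).sub has.mul_left)
    · exact (hD.integral_slice hDc).integrable_of_hasCompactSupport hDc.integral_slice
    · exact (gnLower_transport_le hM hN hd hr hκ0 (hb0 s) (ha0 s)).trans
        (hslice s (r * √(1 + T s ^ 2)) (by positivity))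
  have hib : Integrable b := hbc.integrable_of_hasCompactSupport hbs
  have hibT : Integrable fun s => b s * T s ^ 2 :=
    Continuous.integrable_of_hasCompactSupport (by fun_prop) hbs.mul_right
  have hia : Integrable a := hac.integrable_of_hasCompactSupport has
  have hiTa : Integrable fun s => T' s * a s :=
    Continuous.integrable_of_hasCompactSupport (by fun_prop) has.mul_left
  have hDeval : ∫ s, c * (A * r ^ 2 * (b s + b s * T s ^ 2) - r * (T' s * a s) -
      (d - 1) * r * Y * a s) = c * (A * r ^ 2 * (B + ∫ s, b s * T s ^ 2) -
      r * (∫ s, T' s * a s) - (d - 1) * r * Y * ∫ z, Q z) := by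
    rw [integral_const_mul, integral_sub, integral_sub, integral_const_mul, integral_const_mul,
      integral_const_mul, integral_add hib hibT, hbB, haA]
    · exact (hib.add hibT).const_mul _
    · exact hiTa.const_mul _
    · exact ((hib.add hibT).const_mul _).sub (hiTa.const_mul _)
    · exact hia.const_mul _
  have hTQc : Continuous fun z : ℝ × (Fin k → ℝ) => T' z.1 * Q z := by fun_prop
  have hTQs : HasCompactSupport fun z : ℝ × (Fin k → ℝ) => T' z.1 * Q z := hQs.mul_left
  have hTGc : Continuous fun z : ℝ × (Fin k → ℝ) => T z.1 * G z := by fun_prop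
  have hTGs : HasCompactSupport fun z : ℝ × (Fin k → ℝ) => T z.1 * G z := hGs.mul_left
  have hPTc : Continuous fun z : ℝ × (Fin k → ℝ) => P z * T z.1 ^ 2 := by fun_prop
  have hPTs : HasCompactSupport fun z : ℝ × (Fin k → ℝ) => P z * T z.1 ^ 2 := hPs.mul_right
  have hTa : ∫ s, T' s * a s = ∫ z : ℝ × (Fin k → ℝ), T' z.1 * Q z := by
    rw [integral_prod_eq_of_continuous hTQc hTQs]
    simp only [ha, integral_const_mul]
  have hbT : ∫ s, b s * T s ^ 2 = ∫ z : ℝ × (Fin k → ℝ), P z * T z.1 ^ 2 := by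
    rw [integral_prod_eq_of_continuous hPTc hPTs]
    simp only [hb, integral_mul_const]
  have hIBP : ∫ z : ℝ × (Fin k → ℝ), (T' z.1 * Q z + T z.1 * G z) = 0 := by
    refine integral_eq_zero_of_hasDerivAt_fst (g := fun z => T z.1 * Q z) (by fun_prop)
      hQs.mul_left (by fun_prop) (hTQs.add hTGs) fun s y => ?_
    have h1 : HasDerivAt (fun s => V (s, y)) (W (s, y)) s :=
      ((hV.differentiable one_ne_zero (s, y)).hasFDerivAt.comp_hasDerivAt s
        ((hasDerivAt_id s).prodMk (hasDerivAt_const s y)))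
    have h2 : HasDerivAt (fun x : ℝ => |x| ^ q) (q * |V (s, y)| ^ (q - 2) * V (s, y))
        (V (s, y)) := hasDerivAt_abs_rpow _ (by linarith)
    have h3 : HasDerivAt (fun s => Q (s, y)) (G (s, y)) s :=
      HasDerivAt.comp (h := fun s => V (s, y)) (h₂ := fun x : ℝ => |x| ^ q) s h2 h1
    exact (hT s).mul h3
  rw [integral_add (hTQc.integrable_of_hasCompactSupport hTQs)
    (hTGc.integrable_of_hasCompactSupport hTGs)] at hIBP
  have hiW : Integrable fun z => W z ^ 2 := by
    refine Continuous.integrable_of_hasCompactSupport (by fun_prop) ?_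
    simp only [pow_two]
    exact hWs.mul_left
  have hiPT := (hPTc.integrable_of_hasCompactSupport hPTs (μ := volume))
  have hYoung : -(c * r * ∫ z : ℝ × (Fin k → ℝ), T z.1 * G z) ≤
      (∫ z, W z ^ 2) + c * (N - 1) * r ^ 2 * ∫ z : ℝ × (Fin k → ℝ), P z * T z.1 ^ 2 := by
    rw [← integral_const_mul, ← integral_neg, ← integral_const_mul,
      ← integral_add hiW (hiPT.const_mul _)]
    refine integral_mono ?_ (hiW.add (hiPT.const_mul _)) fun z => ?_
    · exact ((hTGc.integrable_of_hasCompactSupport hTGs).const_mul _).neg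
    · exact neg_mul_le_sq_add hN rfl
  rw [integral_add (hD.integrable_of_hasCompactSupport hDc) hiW]
  rw [hDeval, hTa] at hDlow
  rw [← hbT] at hYoung
  have hYeq : Y = (r ^ N * B / (M * J)) ^ (1 / (d - 1)) := by
    rw [hY, hκ]
    congr 1
    field_simp
  unfold gnLower
  rw [← hYeq]
  set I := ∫ s, b s * T s ^ 2 with hI
  have hJI : J₂ / J * B = I := by rw [hTint]; ring
  have hTQ : ∫ z : ℝ × (Fin k → ℝ), T' z.1 * Q z = -∫ z : ℝ × (Fin k → ℝ), T z.1 * G z := by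
    linarith
  rw [hTQ] at hDlow
  have expand : c * ((A + (A - (N - 1)) * (J₂ / J)) * r ^ 2 * B - (d - 1) * r * Y * ∫ z, Q z) =
      c * (A * r ^ 2 * (B + I) - r * (-∫ z : ℝ × (Fin k → ℝ), T z.1 * G z) -
        (d - 1) * r * Y * ∫ z, Q z) - c * r * (∫ z : ℝ × (Fin k → ℝ), T z.1 * G z) -
        c * (N - 1) * r ^ 2 * I := by
    rw [← hJI]; ring
  rw [expand]
  linarith

theorem tendsto_truncated_integral {α : ℝ} (hα : 3 / 2 < α) :
    Tendsto (fun L : ℝ => ∫ y in -L..L, (1 + y ^ 2) ^ (-α)) atTop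
        (𝓝 (√π * Real.Gamma (α - 1 / 2) / Real.Gamma α)) ∧
      Tendsto (fun L : ℝ => (∫ y in -L..L, y ^ 2 * (1 + y ^ 2) ^ (-α)) /
        ∫ y in -L..L, (1 + y ^ 2) ^ (-α)) atTop (𝓝 (1 / (2 * α - 3))) := by
  obtain ⟨hi, he⟩ := integrable_and_integral_one_add_sq_rpow (by linarith : 1 / 2 < α)
  obtain ⟨hi', he'⟩ := integrable_and_integral_sq_mul_one_add_sq_rpow hα
  have h1 := intervalIntegral_tendsto_integral hi tendsto_neg_atTop_atBot tendsto_id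
  have h2 := intervalIntegral_tendsto_integral hi' tendsto_neg_atTop_atBot tendsto_id
  have hpos : 0 < √π * Real.Gamma (α - 1 / 2) / Real.Gamma α := by
    have := Real.Gamma_pos_of_pos (by linarith : 0 < α)
    have := Real.Gamma_pos_of_pos (by linarith : 0 < α - 1 / 2)
    positivity
  refine ⟨he ▸ h1, ?_⟩
  have h3 := h2.div h1 (he ▸ hpos.ne')
  rw [he'] at h3
  have h4 : (∫ y : ℝ, (1 + y ^ 2) ^ (-α)) / (2 * α - 3) / ∫ y : ℝ, (1 + y ^ 2) ^ (-α) =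
      1 / (2 * α - 3) := by
    rw [div_right_comm, div_self (he ▸ hpos.ne')]
  rwa [h4] at h3

theorem gnLower_step {k : ℕ} {N M d A : ℝ} (hM : 0 < M) (hN : 2 < N) (hd : 3 ≤ d)
    {V D : ℝ × (Fin k → ℝ) → ℝ} (hV : ContDiff ℝ 1 V) (hVc : HasCompactSupport V)
    (hD : Continuous D) (hDc : HasCompactSupport D) (hD0 : ∀ z, 0 ≤ D z)
    (hslice : ∀ s r, 0 ≤ r → gnLower N M d A r (∫ y, |V (s, y)| ^ (2 * N / (N - 2)))
      (∫ y, |V (s, y)| ^ (2 * (N - 1) / (N - 2))) ≤ ∫ y, D (s, y))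
    {r : ℝ} (hr : 0 ≤ r) :
    gnLower N (M * (√π * Real.Gamma ((N + d) / 2 - 1 / 2) / Real.Gamma ((N + d) / 2))) (d - 1)
      (A + (A - (N - 1)) * (1 / (N + d - 3))) r
      (∫ z, |V z| ^ (2 * N / (N - 2))) (∫ z, |V z| ^ (2 * (N - 1) / (N - 2))) ≤
      ∫ z, (D z + fderiv ℝ V z (1, 0) ^ 2) := by
  rcases (integral_nonneg fun z => by positivity :
    0 ≤ ∫ z, |V z| ^ (2 * N / (N - 2))).eq_or_lt with hB | hB
  · rw [← hB, gnLower]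
    simp only [mul_zero, zero_div]
    rw [Real.zero_rpow (by have : 0 < d - 1 := by linarith
                           positivity)]
    simp only [mul_zero, zero_mul, sub_zero]
    exact integral_nonneg fun z => add_nonneg (hD0 z) (sq_nonneg _)
  · obtain ⟨h1, h2⟩ := tendsto_truncated_integral (α := (N + d) / 2) (by linarith)
    have hJpos : 0 < √π * Real.Gamma ((N + d) / 2 - 1 / 2) / Real.Gamma ((N + d) / 2) := by
      have := Real.Gamma_pos_of_pos (by linarith : 0 < (N + d) / 2)
      have := Real.Gamma_pos_of_pos (by linarith : 0 < (N + d) / 2 - 1 / 2)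
      positivity
    rw [show 2 * ((N + d) / 2) - 3 = N + d - 3 by ring] at h2
    refine le_of_tendsto (x := atTop) ?_ ((eventually_gt_atTop 0).mono fun L hL =>
      gnLower_step_truncated hM hN (by linarith : 1 < d) hV hVc hD hDc hslice hB (L := L) hL hr)
    unfold gnLower
    refine Tendsto.const_mul _ (Tendsto.sub ?_ ?_)
    · exact ((tendsto_const_nhds.add (h2.const_mul _)).mul_const _).mul_const _
    · refine Tendsto.mul_const _ (Tendsto.const_mul _ (Tendsto.rpow_const ?_ ?_))
      · exact tendsto_const_nhds.div (h1.const_mul _) (mul_pos hM hJpos).ne'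
      · exact Or.inr (by have : 0 < d - 1 := by linarith
                         positivity)

/-- Inserting a coordinate at position `i`, as a continuous linear equivalence. -/
def insertNthL {k : ℕ} (i : Fin (k + 1)) : (ℝ × (Fin k → ℝ)) ≃L[ℝ] (Fin (k + 1) → ℝ) :=
  LinearEquiv.toContinuousLinearEquiv
    { Fin.insertNthEquiv (fun _ => ℝ) i with
      map_add' := fun x y => by
        simp [Fin.insertNthEquiv, Fin.insertNth_add]
      map_smul' := fun c x => by
        ext j
        refine Fin.succAboveCases i ?_ (fun j => ?_) j <;> simp [Fin.insertNthEquiv] }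

theorem insertNthL_apply {k : ℕ} (i : Fin (k + 1)) (z : ℝ × (Fin k → ℝ)) :
    insertNthL i z = i.insertNth (α := fun _ => ℝ) z.1 z.2 := rfl

theorem insertNthL_one_zero {k : ℕ} (i : Fin (k + 1)) :
    insertNthL i (1, 0) = Pi.single i 1 := by
  ext j
  rw [insertNthL_apply]
  refine Fin.succAboveCases i ?_ (fun j => ?_) j <;> simp [Fin.succAbove_ne]

theorem insertNthL_zero_single {k : ℕ} (i : Fin (k + 1)) (j : Fin k) :
    insertNthL i (0, Pi.single j 1) = Pi.single (i.succAbove j) 1 := by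
  ext l
  rw [insertNthL_apply]
  refine Fin.succAboveCases i ?_ (fun l => ?_) l
  · simp [(Fin.succAbove_ne i j).symm]
  · simp [Pi.single_apply]

theorem measurePreserving_insertNthL {k : ℕ} (i : Fin (k + 1)) :
    MeasurePreserving (insertNthL i) volume volume :=
  (volume_preserving_piFinSuccAbove (fun _ => ℝ) i).symm

theorem integral_comp_insertNthL {k : ℕ} (i : Fin (k + 1)) (f : (Fin (k + 1) → ℝ) → ℝ) :
    ∫ z, f (insertNthL i z) = ∫ x, f x :=
  (measurePreserving_insertNthL i).integral_comp
    (insertNthL i).toHomeomorph.measurableEmbedding f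

theorem fderiv_comp_insertNthL {k : ℕ} (i : Fin (k + 1)) {v : (Fin (k + 1) → ℝ) → ℝ}
    (hv : Differentiable ℝ v) (z w : ℝ × (Fin k → ℝ)) :
    fderiv ℝ (fun z => v (insertNthL i z)) z w = fderiv ℝ v (insertNthL i z) (insertNthL i w) := by
  have h := (hv (insertNthL i z)).hasFDerivAt.comp z (insertNthL i).hasFDerivAt
  exact congrArg (fun f => f w) h.fderiv

theorem sum_sq_fderiv_comp_insertNthL {k : ℕ} (i : Fin (k + 1)) {v : (Fin (k + 1) → ℝ) → ℝ}
    (hv : Differentiable ℝ v) (z : ℝ × (Fin k → ℝ)) :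
    ∑ j, fderiv ℝ v (insertNthL i z) (Pi.single j 1) ^ 2 =
      ∑ j : Fin k, fderiv ℝ (fun z => v (insertNthL i z)) z (0, Pi.single j 1) ^ 2 +
        fderiv ℝ (fun z => v (insertNthL i z)) z (1, 0) ^ 2 := by
  rw [Fin.sum_univ_succAbove _ i]
  simp_rw [fderiv_comp_insertNthL i hv, insertNthL_one_zero, insertNthL_zero_single]
  ring

theorem fderiv_slice {k : ℕ} {V : ℝ × (Fin k → ℝ) → ℝ} (hV : Differentiable ℝ V) (s : ℝ)
    (y w : Fin k → ℝ) : fderiv ℝ (fun y => V (s, y)) y w = fderiv ℝ V (s, y) (0, w) := by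
  have h := (hV (s, y)).hasFDerivAt.comp y (hasFDerivAt_prodMk_right s y)
  exact congrArg (fun f => f w) h.fderiv

/-- The integral of `(1 + |y| ^ 2) ^ (-N)` over `ℝ ^ k`. -/
def gnMass (N : ℝ) (k : ℕ) : ℝ := π ^ ((k : ℝ) / 2) * Real.Gamma (N - k / 2) / Real.Gamma N

theorem gnMass_pos {N : ℝ} {k : ℕ} (hN : 2 < N) (hk : (k : ℝ) ≤ N - 2) : 0 < gnMass N k := by
  have := Real.Gamma_pos_of_pos (by linarith : 0 < N)
  have := Real.Gamma_pos_of_pos (by linarith : 0 < N - k / 2)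
  unfold gnMass
  positivity

theorem gnMass_succ {N : ℝ} {k : ℕ} (hN : 2 < N) (hk : (k : ℝ) ≤ N - 2) :
    gnMass N (k + 1) = gnMass N k *
      (√π * Real.Gamma ((N + (N - k)) / 2 - 1 / 2) / Real.Gamma ((N + (N - k)) / 2)) := by
  have := Real.Gamma_pos_of_pos (by linarith : 0 < N)
  have := Real.Gamma_pos_of_pos (by linarith : 0 < N - k / 2)
  unfold gnMass
  rw [show (N + (N - k)) / 2 = N - (k : ℝ) / 2 by ring,
    show N - ((k + 1 : ℕ) : ℝ) / 2 = N - k / 2 - 1 / 2 by push_cast; ring,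
    show ((k + 1 : ℕ) : ℝ) / 2 = k / 2 + 1 / 2 by push_cast; ring,
    Real.rpow_add Real.pi_pos, Real.sqrt_eq_rpow]
  generalize Real.Gamma (N - k / 2 - 1 / 2) = g₁
  generalize Real.Gamma (N - k / 2) = g₂ at *
  field_simp

/-- Sharp Gagliardo–Nirenberg inequality on `ℝ ^ k` of the Del Pino–Dolbeault family. -/
theorem gnLower_le_integral_sum_sq_fderiv {N : ℝ} (hN : 2 < N) (k : ℕ) (hk : (k : ℝ) ≤ N - 2)
    {v : (Fin k → ℝ) → ℝ} (hv : ContDiff ℝ 1 v) (hvc : HasCompactSupport v) {r : ℝ}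
    (hr : 0 ≤ r) :
    gnLower N (gnMass N k) (N - k) ((N - 1) * (2 * N - k) / (2 * N - k - 2)) r
      (∫ x, |v x| ^ (2 * N / (N - 2))) (∫ x, |v x| ^ (2 * (N - 1) / (N - 2))) ≤
      ∫ x, ∑ i, fderiv ℝ v x (Pi.single i 1) ^ 2 := by
  induction k generalizing r with
  | zero =>
    have hN0 : 0 < N := by linarith
    have hN2 : 0 < N - 2 := by linarith
    have hN1 : 0 < N - 1 := by linarith
    have h0 : ∀ f : (Fin 0 → ℝ) → ℝ, ∫ x, f x = f 0 := by
      intro f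
      rw [Measure.volume_pi_eq_dirac (0 : Fin 0 → ℝ), integral_dirac]
    have hM : gnMass N 0 = 1 := by
      have := Real.Gamma_pos_of_pos hN0
      simp [gnMass, this.ne']
    rw [h0, h0, h0, hM, gnLower]
    set w := |v 0|
    have hw : 0 ≤ w := abs_nonneg _
    have h1 : (r ^ N * w ^ (2 * N / (N - 2)) / 1) ^ (1 / (N - ((0 : ℕ) : ℝ))) *
        w ^ (2 * (N - 1) / (N - 2)) = r * w ^ (2 * N / (N - 2)) := by
      rw [Nat.cast_zero, sub_zero, div_one, Real.mul_rpow (by positivity) (by positivity),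
        ← Real.rpow_mul hr, ← Real.rpow_mul hw, mul_one_div_cancel hN0.ne', Real.rpow_one,
        mul_assoc, ← Real.rpow_add_of_nonneg hw (by positivity) (by positivity)]
      congr 2
      field_simp
      ring
    rw [mul_assoc _ ((r ^ N * w ^ (2 * N / (N - 2)) / 1) ^ (1 / (N - ((0 : ℕ) : ℝ)))), h1]
    have h3 : (N - 1) * (2 * N - ((0 : ℕ) : ℝ)) / (2 * N - ((0 : ℕ) : ℝ) - 2) = N := by
      rw [Nat.cast_zero, sub_zero, div_eq_iff (by linarith)]
      ring
    rw [h3]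
    simp only [Nat.cast_zero, Finset.univ_eq_empty, Finset.sum_empty]
    ring_nf
    rfl
  | succ k ih =>
    have hk' : (k : ℝ) + 1 ≤ N - 2 := by exact_mod_cast hk
    set V : ℝ × (Fin k → ℝ) → ℝ := fun z => v (insertNthL 0 z) with hVdef
    set D : ℝ × (Fin k → ℝ) → ℝ := fun z => ∑ j : Fin k, fderiv ℝ V z (0, Pi.single j 1) ^ 2
      with hDdef
    have hV : ContDiff ℝ 1 V := hv.comp (insertNthL 0).contDiff
    have hVc : HasCompactSupport V := hvc.comp_homeomorph (insertNthL 0).toHomeomorph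
    have hD : Continuous D := by
      refine continuous_finsetSum _ fun j _ => ?_
      exact ((hV.continuous_fderiv one_ne_zero).clm_apply continuous_const).pow 2
    have hDc : HasCompactSupport D :=
      (hVc.fderiv ℝ).comp_left
        (g := fun f : ℝ × (Fin k → ℝ) →L[ℝ] ℝ => ∑ j : Fin k, f (0, Pi.single j 1) ^ 2) (by simp)
    have hstep := gnLower_step (gnMass_pos hN (by linarith)) hN (by linarith : 3 ≤ N - k) hV hVc
      hD hDc (fun z => Finset.sum_nonneg fun j _ => sq_nonneg _)
      (A := (N - 1) * (2 * N - k) / (2 * N - k - 2)) (fun s r hr => ?_) hr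
    · rw [← integral_comp_insertNthL 0, ← integral_comp_insertNthL 0, ← integral_comp_insertNthL 0]
      simp_rw [sum_sq_fderiv_comp_insertNthL 0 (hv.differentiable one_ne_zero)]
      convert hstep using 2
      · exact gnMass_succ hN (by linarith)
      · push_cast; ring
      · push_cast
        have h1 : 0 < 2 * N - k - 3 := by linarith
        generalize (k : ℝ) = κ at *
        obtain ⟨d, rfl⟩ : ∃ d, κ = 2 * N - 3 - d := ⟨2 * N - 3 - κ, by ring⟩
        have h2 : d ≠ 0 := by linarith
        have h3 : d + 1 ≠ 0 := by linarith
        rw [show 2 * N - (2 * N - 3 - d + 1) - 2 = d by ring,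
          show 2 * N - (2 * N - 3 - d) - 2 = d + 1 by ring,
          show N + (N - (2 * N - 3 - d)) - 3 = d by ring]
        field_simp
        ring
    · refine (ih (by linarith) (hV.comp (by fun_prop : ContDiff ℝ 1 fun y => (s, y)))
        (hVc.slice s) hr).trans (le_of_eq ?_)
      simp_rw [hDdef, ← fderiv_slice (hV.differentiable one_ne_zero)]
      rfl

theorem exists_hasDerivAt_weight {β : ℝ → ℝ} (hβ : Continuous β) (hβ0 : ∀ t, 0 ≤ β t)
    (hβneg : ∀ t ≤ 0, β t = 0) (hβi : IntegrableOn β (Ioi 0)) (hB : 0 < ∫ t in Ioi 0, β t)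
    {N δ : ℝ} (hN : 2 < N) (hδ : 0 < δ) (hδ' : δ < 1 / 2) :
    ∃ T T' : ℝ → ℝ, Continuous T ∧ Continuous T' ∧ (∀ t, 0 ≤ T t) ∧ (∀ t, 0 ≤ T' t) ∧
      (∀ t, HasDerivAt T (T' t) t) ∧
      (∀ t, T t * T' t = (1 - 2 * δ) / (N * ∫ t in Ioi 0, β t) * β t *
        (1 + T t ^ 2) ^ ((N + 2) / 2)) ∧
      ∫ t in Ioi 0, β t * T t ^ 2 = (∫ t in Ioi 0, β t) / (1 - 2 * δ) *
        (((1 - δ) ^ (1 - 2 / N) / (1 - 2 / N) - (1 - δ)) -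
          (δ ^ (1 - 2 / N) / (1 - 2 / N) - δ)) := by
  have hN0 : 0 < N := by linarith
  have hδ1 : 0 < 1 - 2 * δ := by linarith
  have hN2 : 0 < 1 - 2 / N := by
    rw [sub_pos, div_lt_one hN0]
    exact hN
  set B := ∫ t in Ioi 0, β t with hBdef
  set κ := (1 - 2 * δ) / (N * B) with hκdef
  have hκ : 0 < κ := by positivity
  have hκB : N * κ * B = 1 - 2 * δ := by
    rw [hκdef]
    field_simp
  set F : ℝ → ℝ := fun t => ∫ s in (0 : ℝ)..t, β s with hFdef
  have hF : ∀ t, HasDerivAt F (β t) t := fun t =>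
    intervalIntegral.integral_hasDerivAt_right (hβ.intervalIntegrable _ _)
      hβ.stronglyMeasurable.stronglyMeasurableAtFilter hβ.continuousAt
  have hFc : Continuous F := continuous_iff_continuousAt.2 fun t => (hF t).continuousAt
  have hFtop : Tendsto F atTop (𝓝 B) := intervalIntegral_tendsto_integral_Ioi 0 hβi tendsto_id
  have hFmono : Monotone F := monotone_of_deriv_nonneg (fun t => (hF t).differentiableAt)
    fun t => (hF t).deriv ▸ hβ0 t
  have hF0 : F 0 = 0 := by simp [hFdef]
  have hFle : ∀ t, F t ≤ B := hFmono.ge_of_tendsto hFtop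
  have hFnonneg : ∀ t, 0 ≤ F t := by
    intro t
    rcases le_total 0 t with ht | ht
    · exact hF0 ▸ hFmono ht
    · refine le_of_eq (Eq.symm ?_)
      rw [hFdef]
      simp only
      rw [intervalIntegral.integral_congr (g := fun _ => 0)]
      · simp
      · intro s hs
        rw [uIcc_of_ge ht] at hs
        exact hβneg s hs.2
  set Z : ℝ → ℝ := fun t => 1 - δ - N * κ * F t with hZdef
  have hZδ : ∀ t, δ ≤ Z t := by
    intro t
    have : N * κ * F t ≤ N * κ * B := by gcongr; exact hFle t
    simp only [hZdef]
    linarith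
  have hZpos : ∀ t, 0 < Z t := fun t => hδ.trans_le (hZδ t)
  have hZ1 : ∀ t, Z t < 1 := by
    intro t
    have : 0 ≤ N * κ * F t := by have := hFnonneg t; positivity
    simp only [hZdef]
    linarith
  have hZc : Continuous Z := by fun_prop
  have hZ : ∀ t, HasDerivAt Z (-(N * κ * β t)) t := fun t => ((hF t).const_mul _).const_sub _
  have hsub : ∀ t, 0 < Z t ^ (-2 / N) - 1 := by
    intro t
    rw [sub_pos]
    exact Real.one_lt_rpow_of_pos_of_lt_one_of_neg (hZpos t) (hZ1 t)
      (div_neg_of_neg_of_pos (by norm_num) hN0)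
  set T : ℝ → ℝ := fun t => √(Z t ^ (-2 / N) - 1) with hTdef
  have hTsq : ∀ t, T t ^ 2 = Z t ^ (-2 / N) - 1 := fun t => Real.sq_sqrt (hsub t).le
  have hTpos : ∀ t, 0 < T t := fun t => Real.sqrt_pos.2 (hsub t)
  have hTc : Continuous T :=
    ((hZc.rpow_const fun t => Or.inl (hZpos t).ne').sub continuous_const).sqrt
  set T' : ℝ → ℝ := fun t => κ * β t * (1 + T t ^ 2) ^ ((N + 2) / 2) / T t with hT'def
  have hτ : ∀ t, (1 + T t ^ 2) ^ ((N + 2) / 2) = Z t ^ (-2 / N - 1) := by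
    intro t
    rw [hTsq, add_sub_cancel, ← Real.rpow_mul (hZpos t).le]
    congr 1
    field_simp
    ring
  refine ⟨T, T', hTc, ?_, fun t => (hTpos t).le, fun t => ?_, fun t => ?_, fun t => ?_, ?_⟩
  · refine ((continuous_const.mul hβ).mul ?_).div hTc fun t => (hTpos t).ne'
    exact (continuous_const.add (hTc.pow 2)).rpow_const fun t =>
      Or.inl (add_pos_of_pos_of_nonneg one_pos (sq_nonneg _)).ne'
  · have := hβ0 t
    have := hTpos t
    positivity
  · have h := (((hZ t).rpow_const (p := -2 / N) (Or.inl (hZpos t).ne')).sub_const 1).sqrt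
      (hsub t).ne'
    refine h.congr_deriv ?_
    simp only [hT'def]
    rw [hτ]
    change _ / (2 * T t) = _
    field_simp
  · simp only [hT'def]
    have := (hTpos t).ne'
    field_simp
  · have hderiv : ∀ t, HasDerivAt
        (fun t => -(1 / (N * κ)) * (Z t ^ (1 - 2 / N) / (1 - 2 / N) - Z t)) (β t * T t ^ 2) t := by
      intro t
      have h := (((hZ t).rpow_const (p := 1 - 2 / N) (Or.inl (hZpos t).ne')).div_const
        (1 - 2 / N) |>.sub (hZ t)).const_mul (-(1 / (N * κ)))
      refine h.congr_deriv ?_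
      rw [hTsq, show 1 - 2 / N - 1 = -2 / N by ring]
      have := hN2.ne'
      generalize Z t ^ (-2 / N) = z
      generalize 1 - 2 / N = s at *
      field_simp
      ring
    have hlim : Tendsto (fun t => -(1 / (N * κ)) * (Z t ^ (1 - 2 / N) / (1 - 2 / N) - Z t)) atTop
        (𝓝 (-(1 / (N * κ)) * (δ ^ (1 - 2 / N) / (1 - 2 / N) - δ))) := by
      have hZlim : Tendsto Z atTop (𝓝 δ) := by
        have h := (hFtop.const_mul (N * κ)).const_sub (1 - δ)
        rwa [hκB, show 1 - δ - (1 - 2 * δ) = δ by ring] at h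
      exact (((hZlim.rpow_const (Or.inl hδ.ne')).div_const _).sub hZlim).const_mul _
    rw [integral_Ioi_of_hasDerivAt_of_nonneg' (fun t _ => hderiv t)
      (fun t _ => mul_nonneg (hβ0 t) (sq_nonneg _)) hlim]
    have hZ0 : Z 0 = 1 - δ := by simp [hZdef, hF0]
    rw [hZ0, show B / (1 - 2 * δ) = 1 / (N * κ) by rw [← hκB]; field_simp]
    ring

theorem gnLower_weight_le {m : ℕ} (hm : 1 ≤ m) {w : (Fin m → ℝ) → ℝ} (hw : ContDiff ℝ 1 w)
    (hwc : HasCompactSupport w) {N κ r t T T' : ℝ} (hN : N = m + 2) (hκ : 0 < κ) (hr : 0 ≤ r)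
    (hrN : r ^ N = κ * gnMass N m) (ht : 0 < t) (hT : 0 ≤ T) (hT' : 0 ≤ T')
    (hTT : T * T' = κ * (t * ∫ y, |w y| ^ (2 * N / (N - 2))) * (1 + T ^ 2) ^ ((N + 2) / 2)) :
    (N - 2) ^ 2 / (N - 1) * ((N - 1) * (N + 2) / N * r ^ 2 * (1 + T ^ 2) *
        (t * ∫ y, |w y| ^ (2 * N / (N - 2))) -
        r * (t * T' + T) * ∫ y, |w y| ^ (2 * (N - 1) / (N - 2))) ≤
      t * ∫ y, ∑ i, fderiv ℝ w y (Pi.single i 1) ^ 2 := by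
  have hm' : (1 : ℝ) ≤ m := by exact_mod_cast hm
  have hN2 : 2 < N := by linarith
  have hτ : 0 < 1 + T ^ 2 := by positivity
  have hM : 0 < gnMass N m := gnMass_pos hN2 (by linarith)
  have h := gnLower_le_integral_sum_sq_fderiv hN2 m (by linarith) hw hwc
    (r := r * √(1 + T ^ 2)) (by positivity)
  set b := ∫ y, |w y| ^ (2 * N / (N - 2)) with hb
  set a := ∫ y, |w y| ^ (2 * (N - 1) / (N - 2)) with ha
  have hb0 : 0 ≤ b := integral_nonneg fun y => by positivity
  have ha0 : 0 ≤ a := integral_nonneg fun y => by positivity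
  have hd : N - m = 2 := by linarith
  have hA : (N - 1) * (2 * N - m) / (2 * N - m - 2) = (N - 1) * (N + 2) / N := by
    rw [show 2 * N - (m : ℝ) = N + 2 by linarith]
    ring
  rw [hd, hA, gnLower, mul_pow, Real.sq_sqrt hτ.le] at h
  have hkey : 2 * √(1 + T ^ 2) * ((r * √(1 + T ^ 2)) ^ N * b / gnMass N m) ^ (1 / (2 : ℝ)) ≤
      T' + T / t := by
    have e1 : (r * √(1 + T ^ 2)) ^ N * b / gnMass N m = κ * b * (1 + T ^ 2) ^ (N / 2) := by
      rw [Real.mul_rpow hr (Real.sqrt_nonneg _), hrN, Real.sqrt_eq_rpow, ← Real.rpow_mul hτ.le]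
      field_simp
    have e2 : √(1 + T ^ 2) * (κ * b * (1 + T ^ 2) ^ (N / 2)) ^ (1 / (2 : ℝ)) =
        (T' * (T / t)) ^ (1 / (2 : ℝ)) := by
      rw [Real.sqrt_eq_rpow, ← Real.mul_rpow hτ.le (by positivity)]
      congr 1
      rw [← mul_div_assoc, mul_comm T', hTT, eq_div_iff ht.ne',
        show (N + 2) / 2 = 1 + N / 2 by ring, Real.rpow_add hτ, Real.rpow_one]
      ring
    rw [e1, mul_assoc, e2]
    have := mul_rpow_one_div_le one_lt_two hT' (div_nonneg hT ht.le)
    norm_num at this ⊢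
    exact this
  have hc : 0 ≤ (N - 2) ^ 2 / (N - 1) := div_nonneg (sq_nonneg _) (by linarith)
  refine le_trans ?_ (mul_le_mul_of_nonneg_left h ht.le)
  rw [mul_left_comm t]
  refine mul_le_mul_of_nonneg_left ?_ hc
  have h2 := mul_le_mul_of_nonneg_left hkey (by positivity : 0 ≤ t * r * a)
  have e3 : t * r * a * (T' + T / t) = r * (t * T' + T) * a := by field_simp
  rw [e3] at h2
  linarith

theorem integrableOn_halfSpace {k : ℕ} {f : ℝ × (Fin k → ℝ) → ℝ} {K : Set (ℝ × (Fin k → ℝ))}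
    (hf : ContinuousOn f (Ioi 0 ×ˢ univ)) (hK : IsCompact K) (h0 : ∀ z, z ∉ K → f z = 0) {C : ℝ}
    (hC : ∀ z : ℝ × (Fin k → ℝ), 0 < z.1 → |f z| ≤ C) : IntegrableOn f (Ioi 0 ×ˢ univ) := by
  have hH : MeasurableSet (Ioi (0 : ℝ) ×ˢ (univ : Set (Fin k → ℝ))) :=
    measurableSet_Ioi.prod MeasurableSet.univ
  have h1 : IntegrableOn f ((Ioi 0 ×ˢ univ) ∩ K) := by
    refine ⟨(hf.mono inter_subset_left).aestronglyMeasurable (hH.inter hK.measurableSet),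
      .restrict_of_bounded (C := C) ?_ ?_⟩
    · exact (measure_mono inter_subset_right).trans_lt hK.measure_lt_top
    · exact (ae_restrict_iff' (hH.inter hK.measurableSet)).2 (ae_of_all _ fun z hz => hC z hz.1.1)
  refine h1.of_forall_sdiff_eq_zero hH fun z hz => h0 z fun hzK => hz.2 ⟨hz.1, hzK⟩

theorem setIntegral_halfSpace {k : ℕ} {f : ℝ × (Fin k → ℝ) → ℝ}
    (hf : IntegrableOn f (Ioi 0 ×ˢ univ)) :
    ∫ z in Ioi 0 ×ˢ univ, f z = ∫ t in Ioi 0, ∫ y, f (t, y) := by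
  have := setIntegral_prod (μ := (volume : Measure ℝ)) (ν := (volume : Measure (Fin k → ℝ))) f hf
  rwa [Measure.restrict_univ] at this

theorem setIntegral_halfSpace_eq_zero_of_hasDerivAt {k : ℕ} {g g' : ℝ × (Fin k → ℝ) → ℝ}
    (hg' : IntegrableOn g' (Ioi 0 ×ˢ univ))
    (hd : ∀ t y, 0 < t → HasDerivAt (fun t => g (t, y)) (g' (t, y)) t) {C R : ℝ}
    (hC : ∀ z : ℝ × (Fin k → ℝ), 0 < z.1 → |g z| ≤ C * z.1)
    (hR : ∀ z : ℝ × (Fin k → ℝ), R < z.1 → g z = 0) :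
    ∫ z in Ioi 0 ×ˢ univ, g' z = 0 := by
  have hprod : (volume.restrict (Ioi (0 : ℝ) ×ˢ (univ : Set (Fin k → ℝ)))) =
      (volume.restrict (Ioi 0)).prod volume := by
    rw [Measure.volume_eq_prod, ← Measure.prod_restrict, Measure.restrict_univ]
  unfold IntegrableOn at hg'
  rw [hprod] at hg' ⊢
  rw [integral_prod_symm _ hg']
  refine integral_eq_zero_of_ae ?_
  filter_upwards [hg'.prod_left_ae] with y hy
  set G : ℝ → ℝ := fun t => if 0 < t then g (t, y) else 0 with hG
  have hG0 : G 0 = 0 := by simp [hG]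
  have hlim : Tendsto G atTop (𝓝 0) := by
    refine tendsto_const_nhds.congr' ?_
    filter_upwards [eventually_gt_atTop R] with t ht
    simp only [hG]
    rw [hR _ ht, ite_self]
  have hGc : ContinuousWithinAt G (Ici 0) 0 := by
    rw [ContinuousWithinAt, hG0]
    have h1 : Tendsto (fun t : ℝ => C * t) (𝓝[≥] 0) (𝓝 0) := by
      have : Continuous fun t : ℝ => C * t := by fun_prop
      have := this.tendsto 0
      rw [mul_zero] at this
      exact this.mono_left nhdsWithin_le_nhds
    refine squeeze_zero_norm' ?_ h1
    filter_upwards [self_mem_nhdsWithin] with t ht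
    rcases (mem_Ici.1 ht).eq_or_lt with rfl | ht
    · simp [hG]
    · simp only [hG, if_pos ht]
      exact hC _ ht
  have hder : ∀ t ∈ Ioi (0 : ℝ), HasDerivAt G (g' (t, y)) t := by
    intro t ht
    refine (hd t y ht).congr_of_eventuallyEq ?_
    filter_upwards [Ioi_mem_nhds ht] with s hs
    simp only [hG, if_pos (mem_Ioi.1 hs)]
  have := integral_Ioi_of_hasDerivAt_of_tendsto hGc hder hy hlim
  rw [this, hG0, sub_zero]
  rfl

theorem exists_bound_of_eq_zero_on_boundary {k : ℕ} {u : ℝ × (Fin k → ℝ) → ℝ}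
    (hu : ContDiff ℝ 1 u) (hc : HasCompactSupport u) (h0 : ∀ y, u (0, y) = 0) :
    ∃ C : ℝ, 0 ≤ C ∧ (∀ z : ℝ × (Fin k → ℝ), |u z| ≤ C * |z.1|) ∧
      ∀ z, |fderiv ℝ u z (1, 0)| ≤ C := by
  obtain ⟨C, hC⟩ := (hc.fderiv ℝ).exists_bound_of_continuous (hu.continuous_fderiv one_ne_zero)
  refine ⟨C, (norm_nonneg _).trans (hC 0), fun z => ?_, fun z => ?_⟩
  · have h := convex_univ.norm_image_sub_le_of_norm_fderiv_le (𝕜 := ℝ) (f := u) (C := C)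
      (fun x _ => hu.differentiable one_ne_zero x) (fun x _ => hC x) (mem_univ (0, z.2))
      (mem_univ z)
    have e : z - (0, z.2) = (z.1, 0) := by ext <;> simp
    rw [h0, sub_zero, e, Prod.norm_mk, norm_zero, max_eq_left (norm_nonneg _)] at h
    exact h
  · have h := (fderiv ℝ u z).le_of_opNorm_le (hC z) (1, 0)
    rwa [Prod.norm_mk, norm_zero, norm_one, max_eq_left zero_le_one, mul_one] at h

theorem continuous_div_sqrt_fst {k : ℕ} {u : ℝ × (Fin k → ℝ) → ℝ} (hu : Continuous u) {C : ℝ}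
    (hC : ∀ z : ℝ × (Fin k → ℝ), |u z| ≤ C * |z.1|) : Continuous fun z => u z / √z.1 := by
  rw [continuous_iff_continuousAt]
  intro z
  rcases lt_or_ge 0 z.1 with hz | hz
  · exact hu.continuousAt.div (by fun_prop) (Real.sqrt_pos.2 hz).ne'
  · have hs : √z.1 = 0 := Real.sqrt_eq_zero_of_nonpos hz
    rw [ContinuousAt, hs, div_zero]
    have h1 : Tendsto (fun z : ℝ × (Fin k → ℝ) => C * √z.1) (𝓝 z) (𝓝 0) := by
      have : Continuous fun z : ℝ × (Fin k → ℝ) => C * √z.1 := by fun_prop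
      have := this.tendsto z
      rwa [hs, mul_zero] at this
    refine squeeze_zero_norm (fun x => ?_) h1
    rcases lt_or_ge 0 x.1 with hx | hx
    · have hp := Real.sqrt_pos.2 hx
      rw [norm_div, Real.norm_eq_abs, Real.norm_eq_abs, abs_of_pos hp, div_le_iff₀ hp, mul_assoc,
        Real.mul_self_sqrt hx.le]
      simpa [abs_of_pos hx] using hC x
    · simp [Real.sqrt_eq_zero_of_nonpos hx]

theorem hasDerivAt_slice_fst {k : ℕ} {u : ℝ × (Fin k → ℝ) → ℝ} (hu : Differentiable ℝ u) (t : ℝ)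
    (y : Fin k → ℝ) : HasDerivAt (fun t => u (t, y)) (fderiv ℝ u (t, y) (1, 0)) t :=
  (hu (t, y)).hasFDerivAt.comp_hasDerivAt t ((hasDerivAt_id t).prodMk (hasDerivAt_const t y))

/-- The derivative in the first variable of the ground state substitution `t ^ (-1 / 2) u`,
multiplied by `t ^ (1 / 2)`. -/
def hardyDeriv {k : ℕ} (u : ℝ × (Fin k → ℝ) → ℝ) (z : ℝ × (Fin k → ℝ)) : ℝ :=
  fderiv ℝ u z (1, 0) - u z / (2 * z.1)

theorem continuousOn_hardyDeriv {k : ℕ} {u : ℝ × (Fin k → ℝ) → ℝ} (hu : ContDiff ℝ 1 u) :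
    ContinuousOn (hardyDeriv u) (Ioi 0 ×ˢ univ) := by
  have h1 := (hu.continuous_fderiv one_ne_zero).clm_apply
    (continuous_const (y := ((1 : ℝ), (0 : Fin k → ℝ))))
  refine h1.continuousOn.sub (hu.continuous.continuousOn.div (by fun_prop) fun z hz => ?_)
  have : 0 < z.1 := hz.1
  positivity

theorem hardyDeriv_eq_zero {k : ℕ} {u : ℝ × (Fin k → ℝ) → ℝ} {z : ℝ × (Fin k → ℝ)}
    (hz : z ∉ tsupport u) : hardyDeriv u z = 0 := by
  have h1 : fderiv ℝ u z = 0 := by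
    by_contra h
    exact hz (support_fderiv_subset ℝ h)
  rw [hardyDeriv, h1, image_eq_zero_of_notMem_tsupport hz]
  simp

theorem abs_hardyDeriv_le {k : ℕ} {u : ℝ × (Fin k → ℝ) → ℝ} {C : ℝ}
    (hC : ∀ z : ℝ × (Fin k → ℝ), |u z| ≤ C * |z.1|) (hC' : ∀ z, |fderiv ℝ u z (1, 0)| ≤ C)
    (z : ℝ × (Fin k → ℝ)) (hz : 0 < z.1) : |hardyDeriv u z| ≤ 2 * C := by
  have h1 : |u z / (2 * z.1)| ≤ C := by
    rw [abs_div, abs_of_pos (by positivity : 0 < 2 * z.1), div_le_iff₀ (by positivity)]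
    have := hC z
    have h2 := abs_nonneg (u z)
    rw [abs_of_pos hz] at this
    linarith
  calc |hardyDeriv u z| ≤ |fderiv ℝ u z (1, 0)| + |u z / (2 * z.1)| := abs_sub _ _
    _ ≤ 2 * C := by linarith [hC' z]

theorem integrableOn_and_integral_hardyDeriv_sq {k : ℕ} {u : ℝ × (Fin k → ℝ) → ℝ}
    (hu : ContDiff ℝ 1 u) (hc : HasCompactSupport u) (h0 : ∀ y, u (0, y) = 0) :
    IntegrableOn (fun z => hardyDeriv u z ^ 2) (Ioi 0 ×ˢ univ) ∧
      ∫ z in Ioi 0 ×ˢ univ, hardyDeriv u z ^ 2 =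
        (∫ z in Ioi 0 ×ˢ univ, fderiv ℝ u z (1, 0) ^ 2) -
          1 / 4 * ∫ z in Ioi 0 ×ˢ univ, u z ^ 2 / z.1 ^ 2 := by
  obtain ⟨C, hC0, hC, hC'⟩ := exists_bound_of_eq_zero_on_boundary hu hc h0
  have hut : Continuous fun z => fderiv ℝ u z (1, 0) :=
    (hu.continuous_fderiv one_ne_zero).clm_apply continuous_const
  have hi1 : IntegrableOn (fun z => hardyDeriv u z ^ 2) (Ioi 0 ×ˢ univ) := by
    refine integrableOn_halfSpace ((continuousOn_hardyDeriv hu).pow 2) hc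
      (fun z hz => by simp [hardyDeriv_eq_zero hz]) (C := (2 * C) ^ 2) fun z hz => ?_
    rw [abs_pow]
    exact pow_le_pow_left₀ (abs_nonneg _) (abs_hardyDeriv_le hC hC' z hz) 2
  have hi2 : IntegrableOn (fun z => u z ^ 2 / z.1 ^ 2) (Ioi 0 ×ˢ univ) := by
    refine integrableOn_halfSpace ((hu.continuous.pow 2).continuousOn.div (by fun_prop)
      fun z hz => ?_) hc (fun z hz => by simp [image_eq_zero_of_notMem_tsupport hz])
      (C := C ^ 2) fun z hz => ?_
    · have : 0 < z.1 := hz.1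
      positivity
    · rw [← div_pow, abs_pow, abs_div, abs_of_pos hz]
      refine pow_le_pow_left₀ (by positivity) ?_ 2
      rw [div_le_iff₀ hz]
      simpa [abs_of_pos hz] using hC z
  have hi3 : IntegrableOn (fun z => fderiv ℝ u z (1, 0) ^ 2) (Ioi 0 ×ˢ univ) := by
    refine integrableOn_halfSpace (hut.pow 2).continuousOn hc (fun z hz => ?_)
      (C := C ^ 2) fun z hz => ?_
    · have h1 : fderiv ℝ u z = 0 := by
        by_contra h
        exact hz (support_fderiv_subset ℝ h)
      simp [h1]
    · rw [abs_pow]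
      exact pow_le_pow_left₀ (abs_nonneg _) (hC' z) 2
  refine ⟨hi1, ?_⟩
  have hi4 : IntegrableOn (fun z => fderiv ℝ u z (1, 0) ^ 2 - 1 / 4 * (u z ^ 2 / z.1 ^ 2))
      (Ioi 0 ×ˢ univ) := hi3.sub (hi2.const_mul (1 / 4))
  have hi5 : IntegrableOn (fun z => 2 * (fderiv ℝ u z (1, 0) ^ 2 -
      1 / 4 * (u z ^ 2 / z.1 ^ 2) - hardyDeriv u z ^ 2)) (Ioi 0 ×ˢ univ) :=
    (hi4.sub hi1).const_mul 2
  obtain ⟨R, hR⟩ := (hc.isCompact.image continuous_fst).bddAbove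
  have h := setIntegral_halfSpace_eq_zero_of_hasDerivAt (g := fun z => u z ^ 2 / z.1) hi5
    (C := C ^ 2) (R := R) ?_ ?_ ?_
  · rw [integral_const_mul, integral_sub hi4 hi1, integral_sub hi3 (hi2.const_mul (1 / 4)), integral_const_mul] at h
    linarith
  · intro t y ht
    have h1 := ((hasDerivAt_slice_fst (hu.differentiable one_ne_zero) t y).pow 2).div
      (hasDerivAt_id t) ht.ne'
    refine h1.congr_deriv ?_
    simp only [Pi.pow_apply, hardyDeriv, id]
    have := ht.ne'
    push_cast
    field_simp
    ring
  · intro z hz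
    rw [abs_div, abs_pow, abs_of_pos hz, div_le_iff₀ hz]
    have := pow_le_pow_left₀ (abs_nonneg _) (hC z) 2
    rw [abs_of_pos hz] at this
    linarith
  · intro z hz
    have : z ∉ tsupport u := fun h => (hR ⟨z, h, rfl⟩).not_gt hz
    simp [image_eq_zero_of_notMem_tsupport this]

theorem MeasureTheory.IntegrableOn.integral_slice_fst {k : ℕ} {f : ℝ × (Fin k → ℝ) → ℝ}
    (hf : IntegrableOn f (Ioi 0 ×ˢ univ)) : IntegrableOn (fun t => ∫ y, f (t, y)) (Ioi 0) := by
  have h : (volume.restrict (Ioi (0 : ℝ) ×ˢ (univ : Set (Fin k → ℝ)))) =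
      (volume.restrict (Ioi 0)).prod volume := by
    rw [Measure.volume_eq_prod, ← Measure.prod_restrict, Measure.restrict_univ]
  rw [IntegrableOn, h] at hf
  exact hf.integral_prod_left

theorem hasDerivAt_mul_weight_mul_abs_rpow {k : ℕ} {u : ℝ × (Fin k → ℝ) → ℝ}
    (hu : Differentiable ℝ u) {T : ℝ → ℝ} {T' t q : ℝ} (hT : HasDerivAt T T' t) (hq : 1 < q)
    (ht : 0 < t) (y : Fin k → ℝ) :
    HasDerivAt (fun t => t * T t * |u (t, y) / √t| ^ q)
      ((t * T' + T t) * |u (t, y) / √t| ^ q + √t * T t *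
        (q * |u (t, y) / √t| ^ (q - 2) * (u (t, y) / √t)) * hardyDeriv u (t, y)) t := by
  have hs : 0 < √t := Real.sqrt_pos.2 ht
  have hs2 : √t * √t = t := Real.mul_self_sqrt ht.le
  have hv : HasDerivAt (fun t => u (t, y) / √t) (hardyDeriv u (t, y) / √t) t := by
    have h := (hasDerivAt_slice_fst hu t y).div (Real.hasDerivAt_sqrt ht.ne') hs.ne'
    refine h.congr_deriv ?_
    have e : hardyDeriv u (t, y) = fderiv ℝ u (t, y) (1, 0) - u (t, y) / (2 * √t ^ 2) := by
      rw [Real.sq_sqrt ht.le]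
      rfl
    rw [e]
    field_simp
  have h1 := HasDerivAt.comp (h := fun t => u (t, y) / √t) (h₂ := fun w : ℝ => |w| ^ q) t
    (hasDerivAt_abs_rpow (u (t, y) / √t) hq) hv
  have h2 := ((hasDerivAt_id t).mul hT).mul h1
  refine h2.congr_deriv ?_
  simp only [Function.comp, Pi.mul_apply, id]
  generalize |u (t, y) / √t| ^ q = X
  generalize |u (t, y) / √t| ^ (q - 2) = Y
  generalize hw : u (t, y) / √t = w
  have : t / √t = √t := by rw [div_eq_iff hs.ne', hs2]
  linear_combination T t * (q * Y * w) * hardyDeriv u (t, y) * this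

theorem integral_sum_sq_fderiv_slice {k : ℕ} {u : ℝ × (Fin k → ℝ) → ℝ}
    (hu : Differentiable ℝ u) {t : ℝ} (ht : 0 < t) :
    ∫ y, ∑ i, fderiv ℝ u (t, y) (0, Pi.single i 1) ^ 2 =
      t * ∫ y, ∑ i, fderiv ℝ (fun y => u (t, y) / √t) y (Pi.single i 1) ^ 2 := by
  rw [← integral_const_mul]
  congr 1 with y
  rw [Finset.mul_sum]
  refine Finset.sum_congr rfl fun i _ => ?_
  have h : fderiv ℝ (fun y => u (t, y) / √t) y (Pi.single i 1) =
      (√t)⁻¹ * fderiv ℝ u (t, y) (0, Pi.single i 1) := by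
    rw [← fderiv_slice hu]
    have h := (hu.comp (by fun_prop : Differentiable ℝ fun y : Fin k → ℝ => (t, y))
      y).hasFDerivAt.const_mul (√t)⁻¹
    have e : (fun y => u (t, y) / √t) = fun y => (√t)⁻¹ * u (t, y) := by
      ext y
      exact div_eq_inv_mul _ _
    rw [e]
    exact congrArg (fun f => f (Pi.single i 1)) h.fderiv
  rw [h, mul_pow, inv_pow, Real.sq_sqrt ht.le, mul_inv_cancel_left₀ ht.ne']

theorem setIntegral_weight_add_eq_zero {k : ℕ} {u : ℝ × (Fin k → ℝ) → ℝ} (hu : ContDiff ℝ 1 u)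
    (hc : HasCompactSupport u) (h0 : ∀ y, u (0, y) = 0) {T T' : ℝ → ℝ} (hT : Continuous T)
    (hT' : Continuous T') (hd : ∀ t, HasDerivAt T (T' t) t) {q : ℝ} (hq : 2 < q) :
    IntegrableOn (fun z => √z.1 * T z.1 * (q * |u z / √z.1| ^ (q - 2) * (u z / √z.1)) *
      hardyDeriv u z) (Ioi 0 ×ˢ univ) ∧
    (∫ z in Ioi 0 ×ˢ univ, (z.1 * T' z.1 + T z.1) * |u z / √z.1| ^ q) +
      ∫ z in Ioi 0 ×ˢ univ, √z.1 * T z.1 * (q * |u z / √z.1| ^ (q - 2) * (u z / √z.1)) *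
        hardyDeriv u z = 0 := by
  obtain ⟨C, hC0, hC, hC'⟩ := exists_bound_of_eq_zero_on_boundary hu hc h0
  have hderiv := fun t y (ht : 0 < t) => hasDerivAt_mul_weight_mul_abs_rpow
    (hu.differentiable one_ne_zero) (hd t) (by linarith : 1 < q) ht y
  obtain ⟨v, hv⟩ : ∃ v : ℝ × (Fin k → ℝ) → ℝ, v = fun z => u z / √z.1 := ⟨_, rfl⟩
  have hvz : ∀ z, u z / √z.1 = v z := fun z => by rw [hv]
  have hvt : ∀ t y, u (t, y) / √t = v (t, y) := fun t y => by rw [hv]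
  simp only [hvz]
  simp only [hvt] at hderiv
  have hvc : Continuous v := hv ▸ continuous_div_sqrt_fst hu.continuous hC
  have hvcs : HasCompactSupport v := hc.mono fun z hz h => hz (by rw [hv]; simp [h])
  have hTz : Continuous fun z : ℝ × (Fin k → ℝ) => T z.1 := hT.comp continuous_fst
  have hT'z : Continuous fun z : ℝ × (Fin k → ℝ) => T' z.1 := hT'.comp continuous_fst
  have hvq := continuous_abs_rpow_comp hvc (by linarith : 0 ≤ q)
  have hvqc := hvcs.abs_rpow (by linarith : q ≠ 0)
  have hA : IntegrableOn (fun z => (z.1 * T' z.1 + T z.1) * |v z| ^ q) (Ioi 0 ×ˢ univ) :=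
    (Continuous.integrable_of_hasCompactSupport
      (((continuous_fst.mul hT'z).add hTz).mul hvq) hvqc.mul_left).integrableOn
  have hpsi : Continuous fun z : ℝ × (Fin k → ℝ) =>
      √z.1 * T z.1 * (q * |v z| ^ (q - 2) * v z) :=
    (((continuous_fst.sqrt).mul hTz).mul ((continuous_const.mul
      (continuous_abs_rpow_comp hvc (by linarith))).mul hvc))
  obtain ⟨C₁, hC₁⟩ := (HasCompactSupport.mul_left hvcs.mul_left :
    HasCompactSupport fun z : ℝ × (Fin k → ℝ) =>
      √z.1 * T z.1 * (q * |v z| ^ (q - 2) * v z)).exists_bound_of_continuous hpsi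
  have hX : IntegrableOn (fun z => √z.1 * T z.1 * (q * |v z| ^ (q - 2) * v z) * hardyDeriv u z)
      (Ioi 0 ×ˢ univ) := by
    refine integrableOn_halfSpace (hpsi.continuousOn.mul (continuousOn_hardyDeriv hu)) hc
      (fun z hz => by rw [hardyDeriv_eq_zero hz, mul_zero]) (C := C₁ * (2 * C)) fun z hz => ?_
    rw [abs_mul]
    exact mul_le_mul (hC₁ z) (abs_hardyDeriv_le hC hC' z hz) (abs_nonneg _)
      ((norm_nonneg _).trans (hC₁ z))
  refine ⟨hX, ?_⟩
  obtain ⟨C₂, hC₂⟩ := (HasCompactSupport.mul_left hvqc :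
    HasCompactSupport fun z : ℝ × (Fin k → ℝ) =>
      T z.1 * |v z| ^ q).exists_bound_of_continuous (hTz.mul hvq)
  obtain ⟨R, hR⟩ := (hc.isCompact.image continuous_fst).bddAbove
  rw [← integral_add hA hX]
  refine setIntegral_halfSpace_eq_zero_of_hasDerivAt
    (g := fun z => z.1 * T z.1 * |v z| ^ q)
    (g' := fun z => (z.1 * T' z.1 + T z.1) * |v z| ^ q +
      √z.1 * T z.1 * (q * |v z| ^ (q - 2) * v z) * hardyDeriv u z)
    (hA.add hX) (fun t y ht => ?_) (C := C₂) (R := R) (fun z hz => ?_) fun z hz => ?_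
  · exact hderiv t y ht
  · rw [mul_assoc, abs_mul, abs_of_pos hz, mul_comm]
    exact mul_le_mul_of_nonneg_right (hC₂ z) hz.le
  · have h1 : z ∉ tsupport u := fun h => (hR ⟨z, h, rfl⟩).not_gt hz
    have h2 : v z = 0 := by rw [← hvz, image_eq_zero_of_notMem_tsupport h1, zero_div]
    rw [h2, abs_zero, Real.zero_rpow (by linarith), mul_zero]

theorem weighted_truncated_le {m : ℕ} (hm : 1 ≤ m) {u : ℝ × (Fin m → ℝ) → ℝ}
    (hu : ContDiff ℝ 1 u) (hc : HasCompactSupport u) (h0 : ∀ y, u (0, y) = 0) {N δ r B : ℝ}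
    (hN : N = m + 2) (hδ : 0 < δ) (hδ' : δ < 1 / 2) (hr : 0 ≤ r)
    (hB : ∫ z in Ioi 0 ×ˢ univ, z.1 * |u z / √z.1| ^ (2 * N / (N - 2)) = B) (hB0 : 0 < B)
    (hrN : r ^ N = (1 - 2 * δ) / (N * B) * gnMass N m) :
    (N - 2) ^ 2 / (N - 1) * r ^ 2 * ((N - 1) * (N + 2) / N * B +
        ((N - 1) * (N + 2) / N - (N - 1)) * (B / (1 - 2 * δ) *
          (((1 - δ) ^ (1 - 2 / N) / (1 - 2 / N) - (1 - δ)) -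
            (δ ^ (1 - 2 / N) / (1 - 2 / N) - δ)))) ≤
      (∫ z in Ioi 0 ×ˢ univ, ∑ i, fderiv ℝ u z (0, Pi.single i 1) ^ 2) +
        ∫ z in Ioi 0 ×ˢ univ, hardyDeriv u z ^ 2 := by
  have hm' : (1 : ℝ) ≤ m := by exact_mod_cast hm
  have hN2 : 2 < N := by linarith
  have hN20 : 0 < N - 2 := by linarith
  have hN0 : 0 < N := by linarith
  have hH : MeasurableSet (Ioi (0 : ℝ) ×ˢ (univ : Set (Fin m → ℝ))) :=
    measurableSet_Ioi.prod MeasurableSet.univ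
  obtain ⟨p, hp⟩ : ∃ p, p = 2 * N / (N - 2) := ⟨_, rfl⟩
  obtain ⟨q, hq⟩ : ∃ q, q = 2 * (N - 1) / (N - 2) := ⟨_, rfl⟩
  obtain ⟨c, hcdef⟩ : ∃ c, c = (N - 2) ^ 2 / (N - 1) := ⟨_, rfl⟩
  obtain ⟨α, hα⟩ : ∃ α, α = (N - 1) * (N + 2) / N := ⟨_, rfl⟩
  have hp0 : 0 < p := by rw [hp]; positivity
  have hq2 : 2 < q := by
    rw [hq, lt_div_iff₀ hN20]
    linarith
  obtain ⟨C, -, hC, -⟩ := exists_bound_of_eq_zero_on_boundary hu hc h0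
  rw [← hp] at hB
  have hslice := fun t (ht : 0 < t) =>
    integral_sum_sq_fderiv_slice (hu.differentiable one_ne_zero) ht
  have hwt : ∀ t, ContDiff ℝ 1 fun y => u (t, y) / √t := fun t =>
    (hu.comp (contDiff_prodMk_right t)).div_const √t
  have hweight := fun (T T' : ℝ → ℝ) (h1 : Continuous T) (h2 : Continuous T')
    (h3 : ∀ t, HasDerivAt T (T' t) t) => setIntegral_weight_add_eq_zero hu hc h0 h1 h2 h3 hq2
  obtain ⟨v, hv⟩ : ∃ v : ℝ × (Fin m → ℝ) → ℝ, v = fun z => u z / √z.1 := ⟨_, rfl⟩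
  have hvz : ∀ z, u z / √z.1 = v z := fun z => by rw [hv]
  have hvt : ∀ t y, u (t, y) / √t = v (t, y) := fun t y => by rw [hv]
  simp only [hvt] at hslice hwt hweight hB
  have hvc : Continuous v := hv ▸ continuous_div_sqrt_fst hu.continuous hC
  have hvcs : HasCompactSupport v := hc.mono fun z hz h => hz (by rw [hv]; simp [h])
  have hvneg : ∀ z : ℝ × (Fin m → ℝ), z.1 ≤ 0 → v z = 0 := fun z hz => by
    simp [hv, Real.sqrt_eq_zero_of_nonpos hz]
  have hvp := continuous_abs_rpow_comp hvc hp0.le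
  have hvq := continuous_abs_rpow_comp hvc (by linarith : 0 ≤ q)
  have hvpc := hvcs.abs_rpow hp0.ne'
  have hvqc := hvcs.abs_rpow (by linarith : q ≠ 0)
  obtain ⟨W, hW⟩ : ∃ W : ℝ × (Fin m → ℝ) → ℝ, W = fun z => z.1 * |v z| ^ p := ⟨_, rfl⟩
  have hWc : Continuous W := hW ▸ continuous_fst.mul hvp
  have hWcs : HasCompactSupport W := hW ▸ hvpc.mul_left
  have hint : ∀ f : ℝ × (Fin m → ℝ) → ℝ, Continuous f → HasCompactSupport f →
      IntegrableOn f (Ioi 0 ×ˢ univ) := fun f h1 h2 =>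
    (h1.integrable_of_hasCompactSupport h2).integrableOn
  have hsl : ∀ f : ℝ × (Fin m → ℝ) → ℝ, Continuous f → HasCompactSupport f → ∀ t,
      Integrable fun y => f (t, y) := fun f h1 h2 t =>
    (h1.comp (by fun_prop)).integrable_of_hasCompactSupport (h2.slice t)
  have hW0 : ∀ z : ℝ × (Fin m → ℝ), 0 ≤ W z := by
    intro z
    rcases le_or_gt z.1 0 with h | h
    · simp [hW, hvneg z h, hp0.ne']
    · rw [hW]
      positivity
  replace hB : ∫ z in Ioi 0 ×ˢ univ, W z = B := by rw [hW, ← hB]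
  have hWt : ∀ t, ∫ y, W (t, y) = t * ∫ y, |v (t, y)| ^ p := fun t => by
    rw [hW]
    exact integral_const_mul _ _
  obtain ⟨β, hβ⟩ : ∃ β : ℝ → ℝ, β = fun t => ∫ y, W (t, y) := ⟨_, rfl⟩
  have hβt : ∀ t, ∫ y, W (t, y) = β t := fun t => by rw [hβ]
  have hβB : ∫ t in Ioi 0, β t = B := by
    rw [← hB, setIntegral_halfSpace (hint W hWc hWcs), hβ]
  have hβc : Continuous β := hβ ▸ hWc.integral_slice hWcs
  have hβcs : HasCompactSupport β := hβ ▸ hWcs.integral_slice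
  have hβneg : ∀ t ≤ 0, β t = 0 := by
    intro t ht
    have : ∀ y, v (t, y) = 0 := fun y => hvneg _ ht
    simp [hβ, hW, this, hp0.ne']
  obtain ⟨T, T', hTc, hT'c, hT0, hT'0, hTd, hTT, hTJ⟩ := exists_hasDerivAt_weight hβc
    (fun t => hβt t ▸ integral_nonneg fun y => hW0 (t, y)) hβneg
    (hβc.integrable_of_hasCompactSupport hβcs).integrableOn (hβB ▸ hB0) hN2 hδ hδ'
  rw [hβB] at hTT hTJ
  rw [← hTJ, ← hcdef, ← hα]
  obtain ⟨J, hJ⟩ : ∃ J, J = ∫ t in Ioi 0, β t * T t ^ 2 := ⟨_, rfl⟩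
  rw [← hJ]
  have hTz : Continuous fun z : ℝ × (Fin m → ℝ) => T z.1 := hTc.comp continuous_fst
  have hT'z : Continuous fun z : ℝ × (Fin m → ℝ) => T' z.1 := hT'c.comp continuous_fst
  have hT2 : Continuous fun z : ℝ × (Fin m → ℝ) => T z.1 ^ 2 := hTz.pow 2
  have hWT : IntegrableOn (fun z => W z * T z.1 ^ 2) (Ioi 0 ×ˢ univ) :=
    hint _ (hWc.mul hT2) hWcs.mul_right
  have hJ' : ∫ z in Ioi 0 ×ˢ univ, W z * T z.1 ^ 2 = J := by
    rw [setIntegral_halfSpace hWT, hJ]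
    simp_rw [integral_mul_const, hβt]
  obtain ⟨D, hD⟩ : ∃ D : ℝ × (Fin m → ℝ) → ℝ,
    D = fun z => ∑ i, fderiv ℝ u z (0, Pi.single i 1) ^ 2 := ⟨_, rfl⟩
  have hDz : ∀ z, ∑ i, fderiv ℝ u z (0, Pi.single i 1) ^ 2 = D z := fun z => by rw [hD]
  simp only [hDz] at hslice ⊢
  have hDc : Continuous D := by
    rw [hD]
    refine continuous_finsetSum _ fun j _ => ?_
    exact ((hu.continuous_fderiv one_ne_zero).clm_apply continuous_const).pow 2
  have hDcs : HasCompactSupport D := by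
    rw [hD]
    exact (hc.fderiv ℝ).comp_left
      (g := fun f : ℝ × (Fin m → ℝ) →L[ℝ] ℝ => ∑ j : Fin m, f (0, Pi.single j 1) ^ 2) (by simp)
  have hc0 : 0 < c := by
    have : 0 < N - 1 := by linarith
    rw [hcdef]
    positivity
  obtain ⟨hX, hAX⟩ := hweight T T' hTc hT'c hTd
  have hA := hint (fun z => (z.1 * T' z.1 + T z.1) * |v z| ^ q)
    (((continuous_fst.mul hT'z).add hTz).mul hvq) hvqc.mul_left
  obtain ⟨A, hAdef⟩ : ∃ A, A = ∫ z in Ioi 0 ×ˢ univ, (z.1 * T' z.1 + T z.1) * |v z| ^ q :=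
    ⟨_, rfl⟩
  obtain ⟨X, hXdef⟩ : ∃ X, X = ∫ z in Ioi 0 ×ˢ univ,
    √z.1 * T z.1 * (q * |v z| ^ (q - 2) * v z) * hardyDeriv u z := ⟨_, rfl⟩
  rw [← hAdef, ← hXdef] at hAX
  have h1 : c * (α * r ^ 2 * (B + J) - r * A) ≤ ∫ z in Ioi 0 ×ˢ univ, D z := by
    have hWi := hint W hWc hWcs
    have hDi := hint D hDc hDcs
    have hWWT : IntegrableOn (fun z => W z + W z * T z.1 ^ 2) (Ioi 0 ×ˢ univ) := hWi.add hWT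
    have hG : IntegrableOn (fun z => c * (α * r ^ 2 * (W z + W z * T z.1 ^ 2) -
        r * ((z.1 * T' z.1 + T z.1) * |v z| ^ q))) (Ioi 0 ×ˢ univ) :=
      ((hWWT.const_mul (α * r ^ 2)).sub (hA.const_mul r)).const_mul c
    have hGe : ∫ z in Ioi 0 ×ˢ univ, c * (α * r ^ 2 * (W z + W z * T z.1 ^ 2) -
        r * ((z.1 * T' z.1 + T z.1) * |v z| ^ q)) = c * (α * r ^ 2 * (B + J) - r * A) := by
      rw [integral_const_mul, integral_sub (hWWT.const_mul (α * r ^ 2)) (hA.const_mul r),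
        integral_const_mul, integral_const_mul, integral_add hWi hWT, hJ', hB, hAdef]
    rw [← hGe, setIntegral_halfSpace hG, setIntegral_halfSpace hDi]
    refine setIntegral_mono_on hG.integral_slice_fst hDi.integral_slice_fst measurableSet_Ioi
      fun t ht => ?_
    have hkey := gnLower_weight_le hm (hwt t) (hvcs.slice t) hN
      (κ := (1 - 2 * δ) / (N * B)) (by have : 0 < 1 - 2 * δ := by linarith
                                       positivity) hr hrN ht (hT0 t) (hT'0 t)
      (by rw [hTT t, ← hp, ← hWt, hβt])
    rw [← hslice t ht, ← hp, ← hq, ← hcdef, ← hα] at hkey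
    refine le_trans (le_of_eq ?_) hkey
    have i1 := hsl _ hWc hWcs t
    have i2 := hsl _ hvq hvqc t
    have i3 : Integrable fun y => W (t, y) * T t ^ 2 := i1.mul_const _
    have i4 : Integrable fun y => α * r ^ 2 * (W (t, y) + W (t, y) * T t ^ 2) :=
      (i1.add i3).const_mul _
    have i5 : Integrable fun y => r * ((t * T' t + T t) * |v (t, y)| ^ q) :=
      (i2.const_mul _).const_mul _
    dsimp only
    rw [integral_const_mul, integral_sub i4 i5, integral_const_mul, integral_const_mul,
      integral_const_mul, integral_add i1 i3, integral_mul_const, hWt]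
    ring
  have h2 : 0 ≤ (∫ z in Ioi 0 ×ˢ univ, hardyDeriv u z ^ 2) + c * r * X +
      c * (N - 1) * r ^ 2 * J := by
    have hxi := (integrableOn_and_integral_hardyDeriv_sq hu hc h0).1
    have hxx : IntegrableOn (fun z => hardyDeriv u z ^ 2 + c * r *
        (√z.1 * T z.1 * (q * |v z| ^ (q - 2) * v z) * hardyDeriv u z)) (Ioi 0 ×ˢ univ) :=
      hxi.add (hX.const_mul (c * r))
    rw [hXdef, ← hJ', ← integral_const_mul, ← integral_const_mul,
      ← integral_add hxi (hX.const_mul (c * r)),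
      ← integral_add hxx (hWT.const_mul (c * (N - 1) * r ^ 2))]
    refine setIntegral_nonneg hH fun z hz => ?_
    have hz0 : 0 < z.1 := hz.1
    have h := neg_mul_le_sq_add (r := r) (T := √z.1 * T z.1) (x := hardyDeriv u z) hN2
      (rfl : |v z| ^ (2 * N / (N - 2)) = |v z| ^ (2 * N / (N - 2)))
    rw [← hcdef, ← hq, ← hp, mul_pow, Real.sq_sqrt hz0.le] at h
    rw [hW]
    linear_combination h
  linear_combination h1 + h2 + c * r * hAX

theorem le_of_forall_truncated_le {N M B S : ℝ} (hN : 2 < N) (hM : 0 < M) (hB : 0 < B)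
    (h : ∀ δ r : ℝ, 0 < δ → δ < 1 / 2 → 0 ≤ r → r ^ N = (1 - 2 * δ) / (N * B) * M →
      (N - 2) ^ 2 / (N - 1) * r ^ 2 * ((N - 1) * (N + 2) / N * B +
        ((N - 1) * (N + 2) / N - (N - 1)) * (B / (1 - 2 * δ) *
          (((1 - δ) ^ (1 - 2 / N) / (1 - 2 / N) - (1 - δ)) -
            (δ ^ (1 - 2 / N) / (1 - 2 / N) - δ)))) ≤ S) :
    N * (N - 2) * (M / N) ^ (2 / N) * B ^ (1 - 2 / N) ≤ S := by
  have hN0 : 0 < N := by linarith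
  have hN2 : 0 < 1 - 2 / N := by
    rw [sub_pos, div_lt_one hN0]
    exact hN
  obtain ⟨e, he⟩ : ∃ e, e = 1 - 2 / N := ⟨_, rfl⟩
  rw [← he] at hN2 ⊢
  simp only [← he] at h
  set R : ℝ → ℝ := fun δ => ((1 - 2 * δ) / (N * B) * M) ^ (1 / N) with hR
  have hRc : Continuous R :=
    (by fun_prop : Continuous fun δ : ℝ => (1 - 2 * δ) / (N * B) * M).rpow_const
      fun _ => Or.inr (by positivity)
  have h1 : Continuous fun δ : ℝ => ((1 - δ) ^ e / e - (1 - δ)) - (δ ^ e / e - δ) :=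
    ((((continuous_const.sub continuous_id).rpow_const fun _ => Or.inr hN2.le).div_const e).sub
      (by fun_prop)).sub (((continuous_id.rpow_const fun _ => Or.inr hN2.le).div_const e).sub
      continuous_id)
  have h2 : ContinuousAt (fun δ : ℝ => B / (1 - 2 * δ)) 0 :=
    continuousAt_const.div (by fun_prop) (by norm_num)
  have h3 := (((hRc.continuousAt (x := 0)).pow 2).const_mul ((N - 2) ^ 2 / (N - 1))).mul
    ((h2.mul h1.continuousAt).const_mul ((N - 1) * (N + 2) / N - (N - 1)) |>.const_add
      ((N - 1) * (N + 2) / N * B))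
  have h4 := h3.tendsto.mono_left (nhdsWithin_le_nhds (s := Ioi 0))
  simp only [Pi.mul_apply, Pi.pow_apply] at h4
  refine le_trans (le_of_eq ?_) (le_of_tendsto h4 ?_)
  · have hR0 : R 0 ^ 2 = (M / N) ^ (2 / N) * B ^ (e - 1) := by
      simp only [hR, mul_zero, sub_zero]
      rw [← Real.rpow_natCast, ← Real.rpow_mul (by positivity),
        show 1 / (N * B) * M = M / N * B⁻¹ by field_simp, Real.mul_rpow (by positivity)
          (by positivity), Real.inv_rpow hB.le, ← Real.rpow_neg hB.le, he]
      norm_num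
      congr 1
      · congr 1
        ring
      · congr 1
        ring
    have hBe : B ^ e = B ^ (e - 1) * B := by
      rw [Real.rpow_sub_one hB.ne', div_mul_cancel₀ _ hB.ne']
    rw [hR0, hBe, sub_zero, Real.one_rpow, Real.zero_rpow hN2.ne']
    have : e = (N - 2) / N := by
      rw [he]
      field_simp
    have h5 : N - 2 ≠ 0 := by linarith
    have h6 : N - 1 ≠ 0 := by linarith
    generalize B ^ (e - 1) = Y
    generalize (M / N) ^ (2 / N) = Z
    rw [this]
    field_simp
    ring
  · filter_upwards [Ioo_mem_nhdsGT (by norm_num : (0 : ℝ) < 1 / 2)] with δ hδ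
    have h7 : 0 < 1 - 2 * δ := by linarith [hδ.2]
    refine h δ (R δ) hδ.1 hδ.2 (by positivity) ?_
    simp only [hR]
    rw [← Real.rpow_mul (by positivity), one_div_mul_cancel hN0.ne', Real.rpow_one]

theorem hardy_sobolev_prod {m : ℕ} (hm : 1 ≤ m) {u : ℝ × (Fin m → ℝ) → ℝ}
    (hu : ContDiff ℝ 1 u) (hc : HasCompactSupport u) (h0 : ∀ y, u (0, y) = 0) {N : ℝ}
    (hN : N = m + 2) :
    1 / 4 * (∫ z in Ioi 0 ×ˢ univ, u z ^ 2 / z.1 ^ 2) +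
        N * (N - 2) * (gnMass N m / N) ^ (2 / N) *
          (∫ z in Ioi 0 ×ˢ univ, z.1 * |u z / √z.1| ^ (2 * N / (N - 2))) ^ (1 - 2 / N) ≤
      (∫ z in Ioi 0 ×ˢ univ, ∑ i, fderiv ℝ u z (0, Pi.single i 1) ^ 2) +
        ∫ z in Ioi 0 ×ˢ univ, fderiv ℝ u z (1, 0) ^ 2 := by
  have hm' : (1 : ℝ) ≤ m := by exact_mod_cast hm
  have hN2 : 2 < N := by linarith
  have hN0 : 0 < N := by linarith
  have hH : MeasurableSet (Ioi (0 : ℝ) ×ˢ (univ : Set (Fin m → ℝ))) :=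
    measurableSet_Ioi.prod MeasurableSet.univ
  have h := (integrableOn_and_integral_hardyDeriv_sq hu hc h0).2
  have hB0 : 0 ≤ ∫ z in Ioi 0 ×ˢ (univ : Set (Fin m → ℝ)),
      z.1 * |u z / √z.1| ^ (2 * N / (N - 2)) :=
    setIntegral_nonneg hH fun z hz => mul_nonneg (le_of_lt hz.1) (by positivity)
  suffices hs : N * (N - 2) * (gnMass N m / N) ^ (2 / N) *
      (∫ z in Ioi 0 ×ˢ univ, z.1 * |u z / √z.1| ^ (2 * N / (N - 2))) ^ (1 - 2 / N) ≤
      (∫ z in Ioi 0 ×ˢ univ, ∑ i, fderiv ℝ u z (0, Pi.single i 1) ^ 2) +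
        ∫ z in Ioi 0 ×ˢ univ, hardyDeriv u z ^ 2 by linarith
  rcases hB0.eq_or_lt with hB | hB
  · have hN2' : 1 - 2 / N ≠ 0 := by
      rw [sub_ne_zero, ne_comm]
      exact ((div_lt_one hN0).2 hN2).ne
    rw [← hB, Real.zero_rpow hN2', mul_zero]
    exact add_nonneg (setIntegral_nonneg hH fun z _ => Finset.sum_nonneg fun i _ => sq_nonneg _)
      (setIntegral_nonneg hH fun z _ => sq_nonneg _)
  · exact le_of_forall_truncated_le hN2 (gnMass_pos hN2 (by linarith)) hB
      fun δ r h1 h2 h3 h4 => weighted_truncated_le hm hu hc h0 hN h1 h2 h3 rfl hB h4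

theorem setIntegral_euclidean_halfSpace {k : ℕ} (i : Fin (k + 1))
    (f : EuclideanSpace ℝ (Fin (k + 1)) → ℝ) :
    ∫ x in {x | 0 < x i}, f x =
      ∫ z in Ioi 0 ×ˢ univ, f (WithLp.toLp 2 (insertNthL i z)) := by
  have h := (PiLp.volume_preserving_toLp (Fin (k + 1))).comp (measurePreserving_insertNthL i)
  have he : MeasurableEmbedding (WithLp.toLp 2 ∘ insertNthL i) :=
    ((insertNthL i).trans
      (PiLp.continuousLinearEquiv 2 ℝ _).symm).toHomeomorph.measurableEmbedding
  rw [← h.setIntegral_preimage_emb he]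
  have hs : (WithLp.toLp 2 ∘ insertNthL i) ⁻¹' {x : EuclideanSpace ℝ (Fin (k + 1)) | 0 < x i} =
      Ioi 0 ×ˢ univ := by
    ext z
    simp [insertNthL_apply]
  rw [hs]
  rfl

theorem fderiv_comp_toLp {k : ℕ} {u : EuclideanSpace ℝ (Fin k) → ℝ} (hu : Differentiable ℝ u)
    (y : Fin k → ℝ) (j : Fin k) :
    fderiv ℝ (fun y => u (WithLp.toLp 2 y)) y (Pi.single j 1) =
      fderiv ℝ u (WithLp.toLp 2 y) (EuclideanSpace.single j 1) := by
  have h := (hu (WithLp.toLp 2 y)).hasFDerivAt.comp y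
    (PiLp.continuousLinearEquiv 2 ℝ (fun _ : Fin k => ℝ)).symm.hasFDerivAt
  exact congrArg (fun f => f (Pi.single j 1)) h.fderiv

theorem mul_abs_div_sqrt_rpow {t : ℝ} (ht : 0 < t) (a p : ℝ) :
    t * |a / √t| ^ p = t ^ (1 - p / 2) * |a| ^ p := by
  rw [abs_div, abs_of_nonneg (Real.sqrt_nonneg t),
    Real.div_rpow (abs_nonneg a) (Real.sqrt_nonneg t), Real.sqrt_eq_rpow, ← Real.rpow_mul ht.le,
    Real.rpow_sub ht, Real.rpow_one, show 1 / 2 * p = p / 2 by ring]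
  ring

theorem gnMass_div_rpow {m : ℕ} {N n : ℝ} (hn : n = m + 1) (hN : N = m + 2) :
    (gnMass N m / N) ^ (2 / N) = π ^ (n / N) / (4 * Real.Gamma (n / 2 + 1) ^ (2 / N)) := by
  have hm : (0 : ℝ) ≤ m := m.cast_nonneg
  have hN0 : 0 < N := by linarith
  have hn0 : 0 < n := by linarith
  have hm1 : (m : ℝ) = n - 1 := by linarith
  have hN1 : N = n + 1 := by linarith
  have h1 := Real.Gamma_mul_Gamma_add_half (N / 2)
  have hG : 0 < Real.Gamma (n / 2 + 1) := Real.Gamma_pos_of_pos (by positivity)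
  have hGN : 0 < Real.Gamma N := Real.Gamma_pos_of_pos hN0
  have h2 : gnMass N m / N = π ^ (n / 2) * 2 ^ (-N) / Real.Gamma (n / 2 + 1) := by
    rw [gnMass, show N - (m : ℝ) / 2 = N / 2 + 1 by linarith,
      Real.Gamma_add_one (by positivity), hm1, show (n - 1) / 2 = n / 2 - 1 / 2 by ring,
      Real.rpow_sub Real.pi_pos, ← Real.sqrt_eq_rpow]
    rw [show N / 2 + 1 / 2 = n / 2 + 1 by linarith, show 2 * (N / 2) = N by ring,
      show 1 - N = -N + 1 by ring, Real.rpow_add_one two_ne_zero] at h1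
    have hpi : 0 < √π := Real.sqrt_pos.2 Real.pi_pos
    generalize Real.Gamma (n / 2 + 1) = G at *
    field_simp
    linear_combination h1
  rw [h2, Real.div_rpow (by positivity) hG.le, Real.mul_rpow (by positivity) (by positivity),
    ← Real.rpow_mul Real.pi_pos.le, ← Real.rpow_mul two_pos.le,
    show n / 2 * (2 / N) = n / N by ring, show -N * (2 / N) = -(2 : ℕ) by
      push_cast
      field_simp, Real.rpow_neg two_pos.le, Real.rpow_natCast]
  ring

end

/-- Hardy's inequality with a sharp Sobolev remainder term on the half-space `ℝⁿ₊`: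
`∫ |∇u|² ≥ (1/4) ∫ |u|²/xₙ²
   + (π^{n/(n+1)}(n²−1)/(4 Γ(n/2+1)^{2/(n+1)})) ( ∫ xₙ^{−2/(n−1)} |u|^{2(n+1)/(n−1)} )^{(n−1)/(n+1)}`
for smooth compactly supported `u` vanishing on the boundary `xₙ = 0`. -/
theorem hardy_sobolev_remainder
    (n : ℕ) (hn : 2 ≤ n)
    (u : EuclideanSpace ℝ (Fin n) → ℝ) (hu : ContDiff ℝ (⊤ : ℕ∞) u)
    (hc : HasCompactSupport u)
    (hbd : ∀ x : EuclideanSpace ℝ (Fin n), x ⟨n - 1, by omega⟩ = 0 → u x = 0) :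
    (1 / 4) * (∫ x in {x : EuclideanSpace ℝ (Fin n) | 0 < x ⟨n - 1, by omega⟩},
        (u x) ^ 2 / (x ⟨n - 1, by omega⟩) ^ 2) +
      (π ^ ((n : ℝ) / ((n : ℝ) + 1)) * ((n : ℝ) ^ 2 - 1) /
          (4 * (Real.Gamma ((n : ℝ) / 2 + 1)) ^ (2 / ((n : ℝ) + 1)))) *
        (∫ x in {x : EuclideanSpace ℝ (Fin n) | 0 < x ⟨n - 1, by omega⟩},
            (x ⟨n - 1, by omega⟩) ^ (-(2 : ℝ) / ((n : ℝ) - 1)) *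
              |u x| ^ (2 * ((n : ℝ) + 1) / ((n : ℝ) - 1))) ^
          (((n : ℝ) - 1) / ((n : ℝ) + 1)) ≤
      ∫ x in {x : EuclideanSpace ℝ (Fin n) | 0 < x ⟨n - 1, by omega⟩},
        ∑ i : Fin n, (pdn i u x) ^ 2 := by
  obtain ⟨m, rfl⟩ : ∃ m, n = m + 1 := ⟨n - 1, by omega⟩
  have hm : 1 ≤ m := by omega
  have hm' : (1 : ℝ) ≤ m := by exact_mod_cast hm
  obtain ⟨i, hi⟩ : ∃ i : Fin (m + 1), (⟨m + 1 - 1, by omega⟩ : Fin (m + 1)) = i := ⟨_, rfl⟩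
  simp only [hi] at hbd ⊢
  have hH : MeasurableSet (Set.Ioi (0 : ℝ) ×ˢ (Set.univ : Set (Fin m → ℝ))) :=
    measurableSet_Ioi.prod MeasurableSet.univ
  obtain ⟨v, hv⟩ : ∃ v : (Fin (m + 1) → ℝ) → ℝ, v = fun y => u (WithLp.toLp 2 y) := ⟨_, rfl⟩
  have hvd : ContDiff ℝ 1 v := by
    rw [hv]
    exact (hu.of_le (by exact_mod_cast le_top)).comp
      (PiLp.continuousLinearEquiv 2 ℝ (fun _ : Fin (m + 1) => ℝ)).symm.contDiff
  have hvc : HasCompactSupport v := by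
    rw [hv]
    exact hc.comp_homeomorph
      (PiLp.continuousLinearEquiv 2 ℝ (fun _ : Fin (m + 1) => ℝ)).symm.toHomeomorph
  obtain ⟨U, hU⟩ : ∃ U : ℝ × (Fin m → ℝ) → ℝ, U = fun z => v (insertNthL i z) := ⟨_, rfl⟩
  have hUd : ContDiff ℝ 1 U := hU ▸ hvd.comp (insertNthL i).contDiff
  have hUc : HasCompactSupport U := hU ▸ hvc.comp_homeomorph (insertNthL i).toHomeomorph
  have hU0 : ∀ y, U (0, y) = 0 := by
    intro y
    rw [hU, hv]
    exact hbd _ (by simp [insertNthL_apply])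
  have key := hardy_sobolev_prod hm hUd hUc hU0 (N := m + 2) rfl
  have hgrad : ∀ z, ∑ j, pdn j u (WithLp.toLp 2 (insertNthL i z)) ^ 2 =
      ∑ j, fderiv ℝ U z (0, Pi.single j 1) ^ 2 + fderiv ℝ U z (1, 0) ^ 2 := by
    intro z
    have h := sum_sq_fderiv_comp_insertNthL i (hvd.differentiable one_ne_zero) z
    rw [← hU] at h
    rw [← h, hv]
    simp only [fderiv_comp_toLp (hu.differentiable (by simp)), pdn]
  have hi1 : Continuous fun z => ∑ j, fderiv ℝ U z (0, Pi.single j 1) ^ 2 :=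
    continuous_finsetSum _ fun j _ =>
      ((hUd.continuous_fderiv one_ne_zero).clm_apply continuous_const).pow 2
  have hi2 : Continuous fun z => fderiv ℝ U z (1, 0) ^ 2 :=
    ((hUd.continuous_fderiv one_ne_zero).clm_apply continuous_const).pow 2
  have hs1 : HasCompactSupport fun z => ∑ j, fderiv ℝ U z (0, Pi.single j 1) ^ 2 :=
    (hUc.fderiv ℝ).comp_left
      (g := fun f : ℝ × (Fin m → ℝ) →L[ℝ] ℝ => ∑ j : Fin m, f (0, Pi.single j 1) ^ 2) (by simp)
  have hs2 : HasCompactSupport fun z => fderiv ℝ U z (1, 0) ^ 2 :=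
    (hUc.fderiv ℝ).comp_left
      (g := fun f : ℝ × (Fin m → ℝ) →L[ℝ] ℝ => f (1, 0) ^ 2) (by simp)
  rw [← integral_add (hi1.integrable_of_hasCompactSupport hs1).integrableOn
    (hi2.integrable_of_hasCompactSupport hs2).integrableOn] at key
  have hu' : ∀ z, u (WithLp.toLp 2 (insertNthL i z)) = U z := fun z => by rw [hU, hv]
  have hx : ∀ z : ℝ × (Fin m → ℝ), insertNthL i z i = z.1 := fun z => by simp [insertNthL_apply]
  simp only [setIntegral_euclidean_halfSpace i, hgrad, hu', hx]
  refine le_trans (le_of_eq ?_) key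
  have hW : ∫ z in Set.Ioi 0 ×ˢ Set.univ, z.1 ^ (-(2 : ℝ) / (((m + 1 : ℕ) : ℝ) - 1)) *
      |U z| ^ (2 * (((m + 1 : ℕ) : ℝ) + 1) / (((m + 1 : ℕ) : ℝ) - 1)) =
      ∫ z in Set.Ioi 0 ×ˢ Set.univ,
        z.1 * |U z / √z.1| ^ (2 * ((m : ℝ) + 2) / ((m : ℝ) + 2 - 2)) := by
    refine setIntegral_congr_fun hH fun z hz => ?_
    have hz0 : 0 < z.1 := hz.1
    rw [mul_abs_div_sqrt_rpow hz0]
    push_cast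
    rw [show (m : ℝ) + 1 - 1 = m by ring, show (m : ℝ) + 2 - 2 = m by ring]
    congr 2
    · field_simp
      ring
    · ring
  rw [hW, gnMass_div_rpow (n := m + 1) rfl rfl]
  have h1 : (((m + 1 : ℕ) : ℝ) - 1) / (((m + 1 : ℕ) : ℝ) + 1) = 1 - 2 / ((m : ℝ) + 2) := by
    push_cast
    field_simp
    ring
  have h2 : (((m + 1 : ℕ) : ℝ) + 1) = m + 2 := by
    push_cast
    ring
  rw [h1, h2]
  push_cast
  ring
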